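/- arXiv:math/0207304 — 7 statements merged into one kernel-verified Lean document; each statement's English description precedes it below -/
import Mathlib

section
/- Let a and b be real numbers and let p be a real number with 1 < p ≤ 2. Then |sgn(a)·|a|^(p-1) − sgn(b)·|b|^(p-1)| ≤ 2^(2−p) · |a − b|^(p−1). -/
lemma rpow_add_rpow_le_two_rpow_mul {s x y : ℝ} (hs0 : 0 ≤ s) (hs1 : s ≤ 1)
    (hx : 0 ≤ x) (hy : 0 ≤ y) : x ^ s + y ^ s ≤ 2 ^ (1 - s) * (x + y) ^ s := by
  have h := (Real.concaveOn_rpow hs0 hs1).2 (Set.mem_Ici.2 hx) (Set.mem_Ici.2 hy)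
    (by norm_num : (0 : ℝ) ≤ 1 / 2) (by norm_num : (0 : ℝ) ≤ 1 / 2) (by norm_num)
  simp only [smul_eq_mul] at h
  rw [← mul_add, ← mul_add, Real.mul_rpow (by norm_num) (add_nonneg hx hy), one_div,
    Real.inv_rpow (by norm_num)] at h
  rw [Real.rpow_sub two_pos, Real.rpow_one, div_mul_eq_mul_div, mul_div_assoc,
    div_eq_inv_mul]
  linarith

lemma rpow_sub_rpow_le_two_rpow_mul {s x y : ℝ} (hs0 : 0 ≤ s) (hs1 : s ≤ 1)
    (hy : 0 ≤ y) (hyx : y ≤ x) : x ^ s - y ^ s ≤ 2 ^ (1 - s) * (x - y) ^ s := by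
  have h := Real.rpow_add_le_add_rpow hy (sub_nonneg.2 hyx) hs0 hs1
  rw [add_sub_cancel] at h
  have hc : (1 : ℝ) ≤ 2 ^ (1 - s) := Real.one_le_rpow one_le_two (sub_nonneg.2 hs1)
  have := le_mul_of_one_le_left (Real.rpow_nonneg (sub_nonneg.2 hyx) s) hc
  linarith

lemma sign_mul_abs_rpow_of_nonneg {s x : ℝ} (hs : 0 < s) (hx : 0 ≤ x) :
    Real.sign x * |x| ^ s = x ^ s := by
  rcases hx.eq_or_lt with rfl | hx
  · simp [Real.zero_rpow hs.ne']
  · rw [Real.sign_of_pos hx, abs_of_pos hx, one_mul]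

lemma sign_mul_abs_rpow_of_nonpos {s x : ℝ} (hs : 0 < s) (hx : x ≤ 0) :
    Real.sign x * |x| ^ s = -(-x) ^ s := by
  have h := sign_mul_abs_rpow_of_nonneg hs (neg_nonneg.2 hx)
  rw [Real.sign_neg, abs_neg] at h
  linarith

theorem sign_rpow_diff_le (p a b : ℝ) (hp1 : 1 < p) (hp2 : p ≤ 2) :
    |Real.sign a * |a| ^ (p - 1) - Real.sign b * |b| ^ (p - 1)| ≤
      2 ^ (2 - p) * |a - b| ^ (p - 1) := by
  wlog hab : b ≤ a generalizing a b
  · rw [abs_sub_comm, abs_sub_comm a b]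
    exact this b a (le_of_not_ge hab)
  have hs : 0 < p - 1 := by linarith
  have hs1 : p - 1 ≤ 1 := by linarith
  rw [abs_of_nonneg (sub_nonneg.2 hab), show 2 - p = 1 - (p - 1) by ring]
  rcases le_total 0 b with hb | hb
  · rw [sign_mul_abs_rpow_of_nonneg hs hb, sign_mul_abs_rpow_of_nonneg hs (hb.trans hab),
      abs_of_nonneg (sub_nonneg.2 (Real.rpow_le_rpow hb hab hs.le))]
    exact rpow_sub_rpow_le_two_rpow_mul hs.le hs1 hb hab
  rcases le_total 0 a with ha | ha
  · have hb' : 0 ≤ -b := neg_nonneg.2 hb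
    rw [sign_mul_abs_rpow_of_nonpos hs hb, sign_mul_abs_rpow_of_nonneg hs ha, sub_neg_eq_add,
      abs_of_nonneg (by positivity), sub_eq_add_neg a b]
    exact rpow_add_rpow_le_two_rpow_mul hs.le hs1 ha hb'
  · have hab' : -a ≤ -b := neg_le_neg hab
    rw [sign_mul_abs_rpow_of_nonpos hs hb, sign_mul_abs_rpow_of_nonpos hs ha, neg_sub_neg,
      abs_of_nonneg (sub_nonneg.2 (Real.rpow_le_rpow (neg_nonneg.2 ha) hab' hs.le)),
      ← neg_sub_neg b a]
    exact rpow_sub_rpow_le_two_rpow_mul hs.le hs1 (neg_nonneg.2 ha) hab'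
end

section
/- Let p be a real number with 1 < p < ∞ and let A be a nonempty bounded subset of ℓ^p. Then there exists a point c ∈ ℓ^p such that sup_{x ∈ A} ‖x − c‖ = r(A), i.e. A admits a Chebyshev center in ℓ^p. -/
open scoped ENNReal

noncomputable def chebRadius {p : ℝ≥0∞} [Fact (1 ≤ p)]
    (A : Set (lp (fun _ : ℕ => ℝ) p)) : ℝ :=
  ⨅ y : lp (fun _ : ℕ => ℝ) p, ⨆ x : A, ‖(x : lp (fun _ : ℕ => ℝ) p) - y‖

open scoped Topology

/-- A bounded sequence in `lp E p`, with proper coordinate spaces, has a subsequence converging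
coordinatewise to an element of `lp E p`. -/
theorem lp.exists_subseq_tendsto_coe {α : Type*} [Countable α] {E : α → Type*}
    [∀ i, NormedAddCommGroup (E i)] [∀ i, ProperSpace (E i)] {p : ℝ≥0∞} [Fact (1 ≤ p)]
    {F : ℕ → lp E p} (hF : Bornology.IsBounded (Set.range F)) :
    ∃ (f : lp E p) (φ : ℕ → ℕ), StrictMono φ ∧
      Filter.Tendsto (fun n ↦ (F (φ n) : ∀ i, E i)) Filter.atTop (𝓝 (f : ∀ i, E i)) := by
  obtain ⟨C, hC⟩ := hF.exists_norm_le
  rw [Set.forall_mem_range] at hC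
  have hp : p ≠ 0 := (zero_lt_one.trans_le Fact.out).ne'
  obtain ⟨f, -, φ, hφ, hf⟩ :=
    (isCompact_univ_pi fun i ↦ isCompact_closedBall (0 : E i) C).tendsto_subseq
      (x := fun n ↦ (F n : ∀ i, E i)) fun n i _ ↦
        mem_closedBall_zero_iff.2 ((lp.norm_apply_le_norm hp (F n) i).trans (hC n))
  have hmem : Memℓp f p :=
    lp.memℓp_of_tendsto (F := F ∘ φ) (hF.subset (Set.range_comp_subset_range φ F)) hf
  exact ⟨⟨f, hmem⟩, φ, hφ, hf⟩

theorem Bornology.IsBounded.bddAbove_range_norm_sub {V : Type*} [SeminormedAddCommGroup V]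
    {A : Set V} (hA : Bornology.IsBounded A) (y : V) :
    BddAbove (Set.range fun x : A ↦ ‖(x : V) - y‖) := by
  obtain ⟨C, hC⟩ := hA.exists_norm_le
  refine ⟨C + ‖y‖, ?_⟩
  rintro _ ⟨x, rfl⟩
  exact (norm_sub_le _ _).trans (by gcongr; exact hC x x.2)

theorem exists_chebyshev_center (p : ℝ) (hp : 1 < p) [Fact (1 ≤ ENNReal.ofReal p)]
    (A : Set (lp (fun _ : ℕ => ℝ) (ENNReal.ofReal p)))
    (hne : A.Nonempty) (hbdd : Bornology.IsBounded A) :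
    ∃ c : lp (fun _ : ℕ => ℝ) (ENNReal.ofReal p),
      (⨆ x : A, ‖(x : lp (fun _ : ℕ => ℝ) (ENNReal.ofReal p)) - c‖) = chebRadius A := by
  obtain ⟨a, ha⟩ := hne
  have : Nonempty A := ⟨⟨a, ha⟩⟩
  let V := lp (fun _ : ℕ => ℝ) (ENNReal.ofReal p)
  let R : V → ℝ := fun y ↦ ⨆ x : A, ‖(x : V) - y‖
  have hR : ∀ y, ∀ x ∈ A, ‖x - y‖ ≤ R y := fun y x hx ↦
    le_ciSup (hbdd.bddAbove_range_norm_sub y) ⟨x, hx⟩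
  have hbelow : BddBelow (Set.range R) :=
    ⟨0, Set.forall_mem_range.2 fun y ↦ Real.iSup_nonneg fun _ ↦ norm_nonneg _⟩
  obtain ⟨u, -, hu, hmem⟩ := exists_seq_tendsto_sInf (Set.range_nonempty R) hbelow
  choose y hy using hmem
  obtain rfl : R ∘ y = u := funext hy
  change Filter.Tendsto (R ∘ y) Filter.atTop (𝓝 (chebRadius A)) at hu
  have hybdd : Bornology.IsBounded (Set.range y) := by
    obtain ⟨C, hC⟩ := hu.bddAbove_range
    refine isBounded_iff_forall_norm_le.2 ⟨‖a‖ + C, Set.forall_mem_range.2 fun n ↦ ?_⟩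
    calc ‖y n‖ = ‖a - (a - y n)‖ := by rw [sub_sub_cancel]
      _ ≤ ‖a‖ + ‖a - y n‖ := norm_sub_le _ _
      _ ≤ ‖a‖ + C := by gcongr; exact (hR _ a ha).trans (hC ⟨n, rfl⟩)
  obtain ⟨c, φ, hφ, hc⟩ := lp.exists_subseq_tendsto_coe hybdd
  refine ⟨c, le_antisymm (ciSup_le fun x ↦ le_of_forall_gt_imp_ge_of_dense fun r hr ↦ ?_)
    (ciInf_le hbelow c)⟩
  have hev : ∀ᶠ n in Filter.atTop, ‖(x : V) - y (φ n)‖ ≤ r :=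
    ((hu.comp hφ.tendsto_atTop).eventually_lt_const hr).mono fun n hn ↦
      (hR _ x x.2).trans hn.le
  exact lp.norm_le_of_tendsto hev (hc.const_sub (x : ∀ _ : ℕ, ℝ))
end

section
/- Let p be a real number with 1 < p < ∞, let q = p/(p−1), and let A = {x_1, …, x_n} be a finite nonempty subset of ℓ^p with Chebyshev radius r := r(A) > 0, and let c be a Chebyshev center of A in ℓ^p. Then there exist points y_1, …, y_m ∈ A (m ≤ n), elements f_1, …, f_m of ℓ^q, and positive real numbers α_1, …, α_m such that: (i) ⟨y_i − c, f_i⟩ = ‖y_i − c‖ = r for i = 1, …, m; (ii) ‖f_i‖_q = 1 for i = 1, …, m; (iii) Σ_{i=1}^m α_i · f_i = 0 and Σ_{i=1}^m α_i = 1. -/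
open scoped ENNReal

open Filter Topology

/-- Gordan's alternative for a linear map into a finite-dimensional coordinate space. -/
theorem LinearMap.exists_forall_pos_or_exists_sum_eq_zero {ι E : Type*} [Fintype ι]
    [AddCommGroup E] [Module ℝ E] (T : E →ₗ[ℝ] ι → ℝ) :
    (∃ v, ∀ i, 0 < T v i) ∨
      ∃ w : ι → ℝ, (∀ i, 0 ≤ w i) ∧ ∑ i, w i = 1 ∧ ∀ v, ∑ i, w i * T v i = 0 := by
  classical
  refine or_iff_not_imp_left.2 fun h => ?_
  have hconv : Convex ℝ (Set.univ.pi fun _ : ι => Set.Ioi (0 : ℝ)) :=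
    convex_pi fun _ _ => convex_Ioi 0
  have hopen : IsOpen (Set.univ.pi fun _ : ι => Set.Ioi (0 : ℝ)) :=
    isOpen_set_pi Set.finite_univ fun _ _ => isOpen_Ioi
  have hdisj : Disjoint (Set.univ.pi fun _ : ι => Set.Ioi (0 : ℝ))
      (LinearMap.range T : Set (ι → ℝ)) := by
    rw [Set.disjoint_left]
    rintro _ ha ⟨v, rfl⟩
    exact h ⟨v, fun i => ha i trivial⟩
  obtain ⟨φ, s, hneg, hle⟩ := geometric_hahn_banach_open hconv hopen
    (LinearMap.range T).convex hdisj
  have hs : s ≤ 0 := by simpa using hle 0 (zero_mem _)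
  have hzero (v : E) : φ (T v) = 0 := by
    by_contra hv
    have := hle (((s - 1) / φ (T v)) • T v) ⟨((s - 1) / φ (T v)) • v, map_smul _ _ _⟩
    rw [map_smul, smul_eq_mul, div_mul_cancel₀ _ hv] at this
    linarith
  have hsum (g : ι → ℝ) : φ g = ∑ i, φ (Pi.single i 1) * g i := by
    conv_lhs => rw [pi_eq_sum_univ' g, map_sum]
    refine Finset.sum_congr rfl fun i _ => ?_
    rw [map_smul, smul_eq_mul, mul_comm]
  have hone : φ 1 < 0 := (hneg 1 fun i _ => by simp).trans_le hs
  have hcoord (i : ι) : φ (Pi.single i 1) ≤ 0 := by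
    have hlim : Tendsto (fun ε : ℝ => φ (Pi.single i 1 + ε • 1)) (𝓝[>] 0)
        (𝓝 (φ (Pi.single i 1))) := by
      have : Continuous fun ε : ℝ => φ (Pi.single i 1 + ε • 1) := by fun_prop
      simpa using (this.tendsto 0).mono_left nhdsWithin_le_nhds
    refine le_of_tendsto hlim ?_
    filter_upwards [self_mem_nhdsWithin] with ε hε
    refine ((hneg _ fun j _ => ?_).trans_le hs).le
    have : (0 : ℝ) ≤ (Pi.single i 1 : ι → ℝ) j := by
      rw [Pi.single_apply]; split_ifs <;> norm_num
    have hε' : 0 < ε := hε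
    simpa using add_pos_of_nonneg_of_pos this hε'
  refine ⟨fun i => φ (Pi.single i 1) / φ 1, fun i => div_nonneg_of_nonpos (hcoord i) hone.le, ?_,
    fun v => ?_⟩
  · rw [← Finset.sum_div, div_eq_one_iff_eq hone.ne, hsum 1]
    simp
  · simp_rw [div_mul_eq_mul_div]
    rw [← Finset.sum_div, ← hsum, hzero, zero_div]

/-- The odd extension of `x ↦ x ^ (p - 1)` from the nonnegative reals. -/
noncomputable def signedPow (p x : ℝ) : ℝ := max x 0 ^ (p - 1) - max (-x) 0 ^ (p - 1)

section signedPow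

variable {p : ℝ} (hp : 1 < p)

include hp

theorem continuous_signedPow : Continuous (signedPow p) :=
  ((continuous_id.max continuous_const).rpow_const fun _ => Or.inr (by linarith)).sub
    ((continuous_neg.max continuous_const).rpow_const fun _ => Or.inr (by linarith))

theorem abs_signedPow (x : ℝ) : |signedPow p x| = |x| ^ (p - 1) := by
  have h0 : (0 : ℝ) ^ (p - 1) = 0 := Real.zero_rpow (by linarith)
  rcases le_total 0 x with hx | hx
  · simp [signedPow, hx, h0, abs_of_nonneg, Real.rpow_nonneg]
  · have := Real.rpow_nonneg (neg_nonneg.2 hx) (p - 1)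
    simp [signedPow, hx, h0, abs_of_nonpos, this]

theorem mul_signedPow (x : ℝ) : x * signedPow p x = |x| ^ p := by
  have h0 : (0 : ℝ) ^ (p - 1) = 0 := Real.zero_rpow (by linarith)
  have key {y : ℝ} (hy : 0 ≤ y) : y * y ^ (p - 1) = y ^ p := by
    conv_lhs => rw [← Real.rpow_one_add' hy (by linarith)]
    congr 1; ring
  rcases le_total 0 x with hx | hx
  · simp [signedPow, hx, h0, abs_of_nonneg, key]
  · rw [abs_of_nonpos hx, ← key (neg_nonneg.2 hx)]
    simp [signedPow, hx, h0]

end signedPow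

namespace lp

variable {ι : Type*} {p q : ℝ} (hpq : p.HolderConjugate q)

include hpq in
theorem memℓp_signedPow (u : lp (fun _ : ι => ℝ) (ENNReal.ofReal p)) :
    Memℓp (fun k => signedPow p (u k)) (ENNReal.ofReal q) := by
  have hu := (lp.memℓp u).summable (by simpa [hpq.nonneg] using hpq.pos)
  refine memℓp_gen ?_
  simpa only [Real.norm_eq_abs, abs_signedPow hpq.lt, ENNReal.toReal_ofReal hpq.nonneg,
    ENNReal.toReal_ofReal hpq.symm.nonneg, ← Real.rpow_mul (abs_nonneg _),
    hpq.sub_one_mul_conj] using hu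

/-- The unnormalized duality map from `ℓ^p` to `ℓ^q`. -/
noncomputable def dualityMap (u : lp (fun _ : ι => ℝ) (ENNReal.ofReal p)) :
    lp (fun _ : ι => ℝ) (ENNReal.ofReal q) :=
  ⟨fun k => signedPow p (u k), memℓp_signedPow hpq u⟩

theorem dualityMap_apply (u : lp (fun _ : ι => ℝ) (ENNReal.ofReal p)) (k : ι) :
    dualityMap hpq u k = signedPow p (u k) := rfl

include hpq in
theorem hasSum_abs_rpow (u : lp (fun _ : ι => ℝ) (ENNReal.ofReal p)) :
    HasSum (fun k => |u k| ^ p) (‖u‖ ^ p) := by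
  simpa [ENNReal.toReal_ofReal hpq.nonneg] using
    hasSum_norm (p := ENNReal.ofReal p) (by simpa [hpq.nonneg] using hpq.pos) u

theorem norm_dualityMap_rpow (u : lp (fun _ : ι => ℝ) (ENNReal.ofReal p)) :
    ‖dualityMap hpq u‖ ^ q = ‖u‖ ^ p := by
  refine (hasSum_abs_rpow hpq.symm (dualityMap hpq u)).unique ?_
  simpa only [dualityMap_apply, abs_signedPow hpq.lt, ← Real.rpow_mul (abs_nonneg _),
    hpq.sub_one_mul_conj] using hasSum_abs_rpow hpq u

theorem norm_dualityMap (u : lp (fun _ : ι => ℝ) (ENNReal.ofReal p)) :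
    ‖dualityMap hpq u‖ = ‖u‖ ^ (p - 1) := by
  rw [← Real.rpow_left_inj (norm_nonneg' _) (Real.rpow_nonneg (norm_nonneg' _) _)
    hpq.symm.ne_zero, norm_dualityMap_rpow, ← Real.rpow_mul (norm_nonneg' _), hpq.sub_one_mul_conj]

theorem tsum_mul_dualityMap_self (u : lp (fun _ : ι => ℝ) (ENNReal.ofReal p)) :
    ∑' k, u k * dualityMap hpq u k = ‖u‖ ^ p := by
  simpa only [dualityMap_apply, mul_signedPow hpq.lt] using (hasSum_abs_rpow hpq u).tsum_eq

include hpq in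
theorem summable_mul_of_holderConjugate (u : lp (fun _ : ι => ℝ) (ENNReal.ofReal p))
    (f : lp (fun _ : ι => ℝ) (ENNReal.ofReal q)) : Summable fun k => u k * f k := by
  refine .of_norm ?_
  simpa only [norm_mul] using lp.summable_mul (by
    rwa [ENNReal.toReal_ofReal hpq.nonneg, ENNReal.toReal_ofReal hpq.symm.nonneg]) u f

theorem tsum_mul_dualityMap_le (u w : lp (fun _ : ι => ℝ) (ENNReal.ofReal p)) :
    ∑' k, u k * dualityMap hpq w k ≤ ‖u‖ ^ p / p + ‖w‖ ^ p / q := by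
  rw [← norm_dualityMap_rpow hpq w]
  exact hasSum_le (fun k => Real.young_inequality (u k) (dualityMap hpq w k) hpq)
    (summable_mul_of_holderConjugate hpq u _).hasSum
    (((hasSum_abs_rpow hpq u).div_const p).add
      ((hasSum_abs_rpow hpq.symm (dualityMap hpq w)).div_const q))

theorem tendsto_tsum_mul_dualityMap_sub_smul [Fact (1 ≤ ENNReal.ofReal p)]
    (u v : lp (fun _ : ι => ℝ) (ENNReal.ofReal p)) :
    Tendsto (fun t : ℝ => ∑' k, v k * dualityMap hpq (u - t • v) k) (𝓝 0)
      (𝓝 (∑' k, v k * dualityMap hpq u k)) := by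
  let s : lp (fun _ : ι => ℝ) (ENNReal.ofReal p) :=
    ⟨fun k => ‖u k‖, memℓp_norm_iff.2 (lp.memℓp u)⟩ +
      ⟨fun k => ‖v k‖, memℓp_norm_iff.2 (lp.memℓp v)⟩
  have hs (k : ι) : s k = |u k| + |v k| := rfl
  refine tendsto_tsum_of_dominated_convergence
    (bound := fun k => ‖v k * dualityMap hpq s k‖)
    (summable_mul_of_holderConjugate hpq v (dualityMap hpq s)).norm (fun k => ?_) ?_
  · have : Continuous fun t : ℝ => v k * signedPow p (u k - t * v k) :=
      continuous_const.mul ((continuous_signedPow hpq.lt).comp (by fun_prop))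
    have h0 := this.tendsto 0
    rw [zero_mul, sub_zero] at h0
    exact h0
  · filter_upwards [Metric.ball_mem_nhds (0 : ℝ) one_pos] with t ht k
    rw [mem_ball_zero_iff, Real.norm_eq_abs] at ht
    simp only [norm_mul, dualityMap_apply, Real.norm_eq_abs, abs_signedPow hpq.lt]
    have habs : |(u - t • v) k| ≤ |s k| := by
      change |u k - t * v k| ≤ _
      rw [hs, abs_of_nonneg (by positivity : 0 ≤ |u k| + |v k|)]
      refine (abs_sub _ _).trans (add_le_add_right ?_ _)
      rw [abs_mul]
      exact mul_le_of_le_one_left (abs_nonneg _) ht.le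
    exact mul_le_mul_of_nonneg_left
      (Real.rpow_le_rpow (abs_nonneg _) habs hpq.sub_one_pos.le) (abs_nonneg _)

/-- A direction on which the duality functional of `u` is positive is a descent direction for the
distance to `u`. -/
theorem eventually_norm_sub_smul_lt [Fact (1 ≤ ENNReal.ofReal p)]
    (u v : lp (fun _ : ι => ℝ) (ENNReal.ofReal p)) (h : 0 < ∑' k, v k * dualityMap hpq u k) :
    ∀ᶠ t : ℝ in 𝓝[>] 0, ‖u - t • v‖ < ‖u‖ := by
  filter_upwards [self_mem_nhdsWithin, ((tendsto_tsum_mul_dualityMap_sub_smul hpq u v).eventually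
    (lt_mem_nhds h)).filter_mono nhdsWithin_le_nhds] with t ht hpos
  have ht' : 0 < t := ht
  set w := u - t • v with hw
  have hsplit : ∑' k, u k * dualityMap hpq w k =
      ‖w‖ ^ p + t * ∑' k, v k * dualityMap hpq w k := by
    rw [← tsum_mul_dualityMap_self hpq w, ← tsum_mul_left,
      ← (summable_mul_of_holderConjugate hpq w _).tsum_add
        ((summable_mul_of_holderConjugate hpq v _).mul_left t)]
    refine tsum_congr fun k => ?_
    have : w k = u k - t * v k := rfl
    rw [this]
    ring
  have hle := tsum_mul_dualityMap_le hpq u w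
  have hmul := mul_pos ht' hpos
  have hconj : ‖w‖ ^ p / q = ‖w‖ ^ p - ‖w‖ ^ p / p := by
    rw [div_eq_mul_inv, ← hpq.one_sub_inv]; ring
  have hdiv : ‖w‖ ^ p / p < ‖u‖ ^ p / p := by linarith
  rwa [div_lt_div_iff_of_pos_right hpq.pos,
    Real.rpow_lt_rpow_iff (norm_nonneg _) (norm_nonneg _) hpq.pos] at hdiv

/-- The pairing with finitely many elements of `ℓ^q`, as a linear map on `ℓ^p`. -/
noncomputable def pairingMap {κ : Type*} (g : κ → lp (fun _ : ι => ℝ) (ENNReal.ofReal q)) :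
    lp (fun _ : ι => ℝ) (ENNReal.ofReal p) →ₗ[ℝ] κ → ℝ where
  toFun v i := ∑' k, v k * g i k
  map_add' u v := by
    ext i
    simp only [coeFn_add, Pi.add_apply, add_mul]
    exact (summable_mul_of_holderConjugate hpq u (g i)).tsum_add
      (summable_mul_of_holderConjugate hpq v (g i))
  map_smul' t v := by
    ext i
    simp only [coeFn_smul, Pi.smul_apply, smul_eq_mul, mul_assoc, tsum_mul_left, RingHom.id_apply]

theorem pairingMap_apply {κ : Type*} (g : κ → lp (fun _ : ι => ℝ) (ENNReal.ofReal q))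
    (v : lp (fun _ : ι => ℝ) (ENNReal.ofReal p)) (i : κ) :
    pairingMap hpq g v i = ∑' k, v k * g i k := rfl

theorem sum_smul_eq_zero_of_pairingMap [Fact (1 ≤ ENNReal.ofReal q)] {κ : Type*} [Fintype κ]
    (g : κ → lp (fun _ : ι => ℝ) (ENNReal.ofReal q)) (w : κ → ℝ)
    (h : ∀ v, ∑ i, w i * pairingMap hpq g v i = 0) : ∑ i, w i • g i = 0 := by
  classical
  ext k
  have hk := h (lp.single _ k 1)
  have hsingle (i : κ) : pairingMap hpq g (lp.single _ k 1) i = g i k := by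
    rw [pairingMap_apply, tsum_eq_single k fun j hj => by
      rw [lp.single_apply_ne _ _ _ hj, zero_mul], lp.single_apply_self, one_mul]
  simp_rw [hsingle] at hk
  exact (congrFun (coeFn_sum (fun i => w i • g i) Finset.univ) k).trans
    ((Finset.sum_apply k _ _).trans hk)

end lp

theorem norm_sub_le_iSup_range {κ E : Type*} [Finite κ] [SeminormedAddCommGroup E] (x : κ → E)
    (y : E) (i : κ) : ‖x i - y‖ ≤ ⨆ a : Set.range x, ‖(a : E) - y‖ :=
  le_ciSup (f := fun a : Set.range x => ‖(a : E) - y‖) (Set.finite_range _).bddAbove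
    ⟨x i, Set.mem_range_self i⟩

theorem exists_chebRadius_le_norm_sub {κ : Type*} [Finite κ] [Nonempty κ] {P : ℝ≥0∞}
    [Fact (1 ≤ P)] (x : κ → lp (fun _ : ℕ => ℝ) P) (y : lp (fun _ : ℕ => ℝ) P) :
    ∃ i, chebRadius (Set.range x) ≤ ‖x i - y‖ := by
  obtain ⟨⟨_, i, rfl⟩, hi⟩ := exists_eq_ciSup_of_finite
    (f := fun a : Set.range x => ‖(a : lp (fun _ : ℕ => ℝ) P) - y‖)
  refine ⟨i, le_trans (ciInf_le ⟨0, ?_⟩ y) hi.ge⟩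
  rintro _ ⟨z, rfl⟩
  exact Real.iSup_nonneg fun _ => norm_nonneg _

theorem subdifferential_decomposition (p q : ℝ) (hp : 1 < p) (hq : q = p / (p - 1))
    [Fact (1 ≤ ENNReal.ofReal p)] [Fact (1 ≤ ENNReal.ofReal q)]
    (n : ℕ) (hn : 0 < n) (x : Fin n → lp (fun _ : ℕ => ℝ) (ENNReal.ofReal p))
    (hr : 0 < chebRadius (Set.range x))
    (c : lp (fun _ : ℕ => ℝ) (ENNReal.ofReal p))
    (hc : (⨆ a : Set.range x, ‖(a : lp (fun _ : ℕ => ℝ) (ENNReal.ofReal p)) - c‖) =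
      chebRadius (Set.range x)) :
    ∃ m : ℕ, m ≤ n ∧
      ∃ (y : Fin m → lp (fun _ : ℕ => ℝ) (ENNReal.ofReal p))
        (f : Fin m → lp (fun _ : ℕ => ℝ) (ENNReal.ofReal q)) (α : Fin m → ℝ),
        (∀ i, y i ∈ Set.range x) ∧
        (∀ i, (∑' k, ((y i : ℕ → ℝ) k - (c : ℕ → ℝ) k) * (f i : ℕ → ℝ) k) =
            chebRadius (Set.range x) ∧
          ‖y i - c‖ = chebRadius (Set.range x)) ∧
        (∀ i, ‖f i‖ = 1) ∧
        (∀ i, 0 < α i) ∧ (∑ i, α i • f i = 0) ∧ (∑ i, α i = 1) := by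
  have hpq : p.HolderConjugate q := (Real.holderConjugate_iff_eq_conjExponent hp).2 hq
  have : Nonempty (Fin n) := ⟨⟨0, hn⟩⟩
  set r := chebRadius (Set.range x)
  have hle (i : Fin n) : ‖x i - c‖ ≤ r := hc ▸ norm_sub_le_iSup_range x c i
  let g (i : {i // ‖x i - c‖ = r}) : lp (fun _ : ℕ => ℝ) (ENNReal.ofReal q) :=
    (r ^ (p - 1))⁻¹ • lp.dualityMap hpq (x i - c)
  have hrpos : 0 < r ^ (p - 1) := Real.rpow_pos_of_pos hr _
  have hpair (v : lp (fun _ : ℕ => ℝ) (ENNReal.ofReal p)) (i : {i // ‖x i - c‖ = r}) :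
      ∑' k, v k * g i k = (r ^ (p - 1))⁻¹ * ∑' k, v k * lp.dualityMap hpq (x i - c) k := by
    rw [← tsum_mul_left]
    refine tsum_congr fun k => ?_
    simp only [g, lp.coeFn_smul, Pi.smul_apply, smul_eq_mul]
    ring
  rcases (lp.pairingMap hpq g).exists_forall_pos_or_exists_sum_eq_zero with
    ⟨v, hv⟩ | ⟨w, hw0, hw1, hw⟩
  · have hev (i : Fin n) : ∀ᶠ t : ℝ in 𝓝[>] 0, ‖x i - c - t • v‖ < r := by
      rcases (hle i).eq_or_lt with hi | hi
      · have hpos := hv ⟨i, hi⟩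
        rw [lp.pairingMap_apply, hpair, mul_pos_iff_of_pos_left (inv_pos.2 hrpos)] at hpos
        simpa only [hi] using lp.eventually_norm_sub_smul_lt hpq (x i - c) v hpos
      · have hcont : Continuous fun t : ℝ => ‖x i - c - t • v‖ := by fun_prop
        exact (hcont.tendsto 0).eventually (gt_mem_nhds (by simpa using hi))
          |>.filter_mono nhdsWithin_le_nhds
    obtain ⟨t, ht⟩ := (eventually_all.2 hev).exists
    obtain ⟨i, hi⟩ := exists_chebRadius_le_norm_sub x (c + t • v)
    rw [← sub_sub] at hi
    exact absurd (ht i) hi.not_gt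
  · classical
    let e := (Fintype.equivFin {i // 0 < w i}).symm
    have hsum {M : Type} [AddCommGroup M] [Module ℝ M] (h : {i // ‖x i - c‖ = r} → M) :
        ∑ j, w (e j) • h (e j) = ∑ i, w i • h i := by
      rw [e.sum_comp fun i => w i • h i,
        ← Finset.sum_subtype (Finset.univ.filter fun i => 0 < w i) (by simp) fun i => w i • h i]
      refine Finset.sum_filter_of_ne fun i _ hi => (hw0 i).lt_of_ne' ?_
      intro hwi
      simp [hwi] at hi
    refine ⟨Fintype.card {i // 0 < w i}, ?_, fun j => x (e j), fun j => g (e j), fun j => w (e j),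
      fun j => Set.mem_range_self _, fun j => ⟨?_, (e j).1.2⟩, fun j => ?_, fun j => (e j).2, ?_, ?_⟩
    · simpa using (Fintype.card_subtype_le _).trans (Fintype.card_subtype_le fun i => ‖x i - c‖ = r)
    · have := hpair (x (e j) - c) (e j)
      rw [lp.tsum_mul_dualityMap_self, (e j).1.2] at this
      refine this.trans ?_
      rw [inv_mul_eq_div, ← Real.rpow_sub hr]
      simp
    · rw [norm_smul, lp.norm_dualityMap, (e j).1.2, Real.norm_of_nonneg (by positivity),
        inv_mul_cancel₀ hrpos.ne']
    · exact (hsum g).trans (lp.sum_smul_eq_zero_of_pairingMap hpq g w hw)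
    · simpa [hw1] using hsum fun _ => (1 : ℝ)
end

section
/- Let p be a real number with 1 < p ≤ 2 and let x, y ∈ ℓ^p. Then Σ_k (x_k − y_k)·(J(x)_k − J(y)_k) ≤ 2^(2−p) · ‖x − y‖^p, where the series on the left converges absolutely. -/
open scoped ENNReal

/-- The coordinatewise duality map on sequences: `(Jmap p x) k = sgn (x k) * |x k| ^ (p - 1)`. -/
noncomputable def Jmap (p : ℝ) (x : ℕ → ℝ) : ℕ → ℝ :=
  fun k => Real.sign (x k) * |x k| ^ (p - 1)

theorem Real.rpow_add_rpow_le_two_rpow_mul {r a b : ℝ} (h0 : 0 ≤ r) (h1 : r ≤ 1)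
    (ha : 0 ≤ a) (hb : 0 ≤ b) : a ^ r + b ^ r ≤ 2 ^ (1 - r) * (a + b) ^ r := by
  have h := (Real.concaveOn_rpow h0 h1).2 (Set.mem_Ici.2 ha) (Set.mem_Ici.2 hb)
    (by norm_num : (0 : ℝ) ≤ 1 / 2) (by norm_num : (0 : ℝ) ≤ 1 / 2) (by norm_num)
  simp only [smul_eq_mul] at h
  rw [← mul_add, ← mul_add, one_div, Real.mul_rpow (by norm_num) (add_nonneg ha hb),
    Real.inv_rpow (by norm_num)] at h
  rw [Real.rpow_sub two_pos, Real.rpow_one, div_eq_mul_inv]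
  linarith

theorem Real.rpow_sub_rpow_le_rpow_sub {r a b : ℝ} (h0 : 0 ≤ r) (h1 : r ≤ 1)
    (hb : 0 ≤ b) (hab : b ≤ a) : a ^ r - b ^ r ≤ (a - b) ^ r := by
  have h := Real.rpow_add_le_add_rpow (sub_nonneg.2 hab) hb h0 h1
  rw [sub_add_cancel] at h
  linarith

theorem Real.abs_rpow_sub_rpow_le {r a b : ℝ} (h0 : 0 ≤ r) (h1 : r ≤ 1)
    (ha : 0 ≤ a) (hb : 0 ≤ b) : |a ^ r - b ^ r| ≤ |a - b| ^ r := by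
  wlog hab : b ≤ a generalizing a b
  · rw [abs_sub_comm, abs_sub_comm a]
    exact this hb ha (le_of_not_ge hab)
  rw [abs_of_nonneg (sub_nonneg.2 hab),
    abs_of_nonneg (sub_nonneg.2 (Real.rpow_le_rpow hb hab h0))]
  exact Real.rpow_sub_rpow_le_rpow_sub h0 h1 hb hab

/-- The signed power `t ↦ sgn t * |t| ^ r` with `0 < r ≤ 1` is `r`-Hölder with constant
`2 ^ (1 - r)`. -/
theorem Real.abs_signed_rpow_sub_le {r : ℝ} (h0 : 0 < r) (h1 : r ≤ 1) (a b : ℝ) :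
    |Real.sign a * |a| ^ r - Real.sign b * |b| ^ r| ≤ 2 ^ (1 - r) * |a - b| ^ r := by
  have signed_nonneg : ∀ t : ℝ, 0 ≤ t → Real.sign t * |t| ^ r = t ^ r := by
    intro t ht
    rcases ht.eq_or_lt with rfl | ht
    · simp [Real.zero_rpow h0.ne']
    · rw [Real.sign_of_pos ht, abs_of_pos ht, one_mul]
  have signed_nonpos : ∀ t : ℝ, t ≤ 0 → Real.sign t * |t| ^ r = -(-t) ^ r := by
    intro t ht
    rw [← signed_nonneg (-t) (neg_nonneg.2 ht), Real.sign_neg, abs_neg, neg_mul, neg_neg]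
  have hC : (1 : ℝ) ≤ 2 ^ (1 - r) := Real.one_le_rpow one_le_two (sub_nonneg.2 h1)
  have same_sign : ∀ {s t : ℝ}, 0 ≤ s → 0 ≤ t → |s ^ r - t ^ r| ≤ 2 ^ (1 - r) * |s - t| ^ r :=
    fun hs ht => (Real.abs_rpow_sub_rpow_le h0.le h1 hs ht).trans
      (le_mul_of_one_le_left (by positivity) hC)
  have opposite_sign : ∀ {s t : ℝ}, 0 ≤ s → 0 ≤ t →
      |s ^ r + t ^ r| ≤ 2 ^ (1 - r) * |s + t| ^ r := by
    intro s t hs ht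
    rw [abs_of_nonneg (by positivity), abs_of_nonneg (by positivity : 0 ≤ s + t)]
    exact Real.rpow_add_rpow_le_two_rpow_mul h0.le h1 hs ht
  rcases le_total 0 a with ha | ha <;> rcases le_total 0 b with hb | hb
  · rw [signed_nonneg a ha, signed_nonneg b hb]
    exact same_sign ha hb
  · rw [signed_nonneg a ha, signed_nonpos b hb, sub_neg_eq_add]
    simpa [sub_eq_add_neg] using opposite_sign ha (neg_nonneg.2 hb)
  · rw [signed_nonpos a ha, signed_nonneg b hb, ← neg_add', abs_neg, abs_sub_comm a]
    simpa [sub_eq_add_neg, add_comm] using opposite_sign (neg_nonneg.2 ha) hb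
  · rw [signed_nonpos a ha, signed_nonpos b hb]
    simpa [sub_eq_add_neg, add_comm] using
      same_sign (neg_nonneg.2 hb) (neg_nonneg.2 ha)

theorem Jmap_abs_pairing_le {p : ℝ} (hp1 : 1 < p) (hp2 : p ≤ 2) (x y : ℕ → ℝ) (k : ℕ) :
    |(x k - y k) * (Jmap p x k - Jmap p y k)| ≤ 2 ^ (2 - p) * |x k - y k| ^ p := by
  have h := Real.abs_signed_rpow_sub_le (sub_pos.2 hp1) (by linarith : p - 1 ≤ 1) (x k) (y k)
  rw [abs_mul]
  calc |x k - y k| * |Jmap p x k - Jmap p y k|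
      ≤ |x k - y k| * (2 ^ (1 - (p - 1)) * |x k - y k| ^ (p - 1)) :=
        mul_le_mul_of_nonneg_left h (abs_nonneg _)
    _ = 2 ^ (2 - p) * (|x k - y k| ^ (1 : ℝ) * |x k - y k| ^ (p - 1)) := by
        rw [Real.rpow_one, show 1 - (p - 1) = 2 - p by ring]
        ring
    _ = 2 ^ (2 - p) * |x k - y k| ^ p := by
        rw [← Real.rpow_add_of_nonneg (abs_nonneg _) zero_le_one (by linarith),
          add_sub_cancel]

theorem duality_pairing_le (p : ℝ) (hp1 : 1 < p) (hp2 : p ≤ 2)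
    [Fact (1 ≤ ENNReal.ofReal p)]
    (x y : lp (fun _ : ℕ => ℝ) (ENNReal.ofReal p)) :
    Summable (fun k => ((x : ℕ → ℝ) k - (y : ℕ → ℝ) k) *
        (Jmap p (x : ℕ → ℝ) k - Jmap p (y : ℕ → ℝ) k)) ∧
    (∑' k, ((x : ℕ → ℝ) k - (y : ℕ → ℝ) k) *
        (Jmap p (x : ℕ → ℝ) k - Jmap p (y : ℕ → ℝ) k)) ≤
      2 ^ (2 - p) * ‖x - y‖ ^ p := by
  have hp : (ENNReal.ofReal p).toReal = p := ENNReal.toReal_ofReal (by linarith)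
  have hnorm := lp.hasSum_norm (by rw [hp]; linarith) (x - y)
  simp only [hp, lp.coeFn_sub, Pi.sub_apply, Real.norm_eq_abs] at hnorm
  have hbound := hnorm.mul_left (2 ^ (2 - p))
  have hle := Jmap_abs_pairing_le hp1 hp2 x y
  have hsum := Summable.of_norm_bounded
    (f := fun k => (x k - y k) * (Jmap p x k - Jmap p y k)) hbound.summable hle
  exact ⟨hsum, hasSum_le (fun k => (le_abs_self _).trans (hle k)) hsum.hasSum hbound⟩
end

section
/- Let p be a real number with p > 2 and let A be a finite nonempty subset of ℓ^p with Chebyshev radius r := r(A) > 0. Then there exist points y_1, …, y_m ∈ A and positive real numbers α_1, …, α_m with Σ_{i=1}^m α_i = 1 such that 2·r^p ≤ Σ_{i=1}^m Σ_{j=1}^m α_i · α_j · ‖y_i − y_j‖^p. -/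
open scoped ENNReal

theorem rpow_add_rpow_add_mul_le_add_rpow {q a b : ℝ} (hq : 2 ≤ q) (ha : 0 < a) (hb : 0 < b) :
    a ^ q + b ^ q + q * a ^ (q - 1) * b ≤ (a + b) ^ q := by
  have superadd : a ^ (q - 1) + b ^ (q - 1) ≤ (a + b) ^ (q - 1) :=
    Real.add_rpow_le_rpow_add ha.le hb.le (by linarith)
  have bernoulli : a ^ (q - 1) * (1 + (q - 1) * (b / a)) ≤ (a + b) ^ (q - 1) := by
    have h := one_add_mul_self_le_rpow_one_add (s := b / a) (p := q - 1)
      (by linarith [div_pos hb ha]) (by linarith)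
    calc a ^ (q - 1) * (1 + (q - 1) * (b / a)) ≤ a ^ (q - 1) * (1 + b / a) ^ (q - 1) := by gcongr
      _ = (a + b) ^ (q - 1) := by
        rw [← Real.mul_rpow ha.le (by positivity)]
        congr 1
        field_simp
  have split : ∀ t : ℝ, 0 < t → t ^ q = t * t ^ (q - 1) := fun t ht => by
    rw [Real.rpow_sub_one ht.ne']
    field_simp
  have h₁ := mul_le_mul_of_nonneg_left superadd hb.le
  have h₂ := mul_le_mul_of_nonneg_left bernoulli ha.le
  have h₃ : a * (a ^ (q - 1) * (1 + (q - 1) * (b / a)))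
      = a * a ^ (q - 1) + (q - 1) * a ^ (q - 1) * b := by
    field_simp
  rw [split a ha, split b hb, split (a + b) (by positivity)]
  nlinarith

theorem rpow_add_rpow_add_mul_add_mul_le_add_rpow {p a b : ℝ} (hp : 3 ≤ p) (ha : 0 < a)
    (hb : 0 < b) :
    a ^ p + b ^ p + p * (a ^ (p - 1) * b + b ^ (p - 1) * a) ≤ (a + b) ^ p := by
  have hab := rpow_add_rpow_add_mul_le_add_rpow (q := p - 1) (by linarith) ha hb
  have hba := rpow_add_rpow_add_mul_le_add_rpow (q := p - 1) (by linarith) hb ha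
  have split : ∀ (t s : ℝ), 0 < t → t ^ s = t * t ^ (s - 1) := fun t s ht => by
    rw [Real.rpow_sub_one ht.ne']
    field_simp
  have h₁ := mul_le_mul_of_nonneg_left hab ha.le
  have h₂ := mul_le_mul_of_nonneg_left hba hb.le
  rw [add_comm b a] at h₂
  have ea := split a (p - 1) ha
  have eb := split b (p - 1) hb
  rw [split a p ha, split b p hb, split (a + b) p (by positivity)]
  rw [ea, eb] at h₁ h₂ ⊢
  nlinarith

theorem rpow_add_rpow_sub_mul_le_sub_rpow {p a b : ℝ} (hp : 3 ≤ p) (hb : 0 < b) (hab : b ≤ a) :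
    a ^ p + b ^ p - p * (a ^ (p - 1) * b + b ^ (p - 1) * a) ≤ (a - b) ^ p := by
  have ha : 0 < a := hb.trans_le hab
  have hle : b / a ≤ 1 := (div_le_one ha).2 hab
  have bernoulli : a ^ p * (1 + p * (-(b / a))) ≤ (a - b) ^ p := by
    have h := one_add_mul_self_le_rpow_one_add (s := -(b / a)) (p := p)
      (by linarith) (by linarith)
    calc a ^ p * (1 + p * (-(b / a))) ≤ a ^ p * (1 + -(b / a)) ^ p := by gcongr
      _ = (a - b) ^ p := by
        rw [← Real.mul_rpow ha.le (by linarith)]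
        congr 1
        field_simp
        ring
  have split : ∀ t : ℝ, 0 < t → t ^ p = t * t ^ (p - 1) := fun t ht => by
    rw [Real.rpow_sub_one ht.ne']
    field_simp
  have h₁ : a ^ p * (1 + p * (-(b / a))) = a ^ p - p * (a ^ (p - 1) * b) := by
    rw [split a ha]
    field_simp
    ring
  have hpos : 0 ≤ b ^ (p - 1) := by positivity
  have h₂ : b ^ p ≤ p * (b ^ (p - 1) * a) := by
    rw [split b hb]
    nlinarith [mul_nonneg hpos ha.le, mul_le_mul_of_nonneg_left hab hpos]
  linarith

theorem abs_rpow_add_abs_rpow_sub_le_abs_sub_rpow {p : ℝ} (hp : 3 ≤ p) (a b : ℝ) :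
    |a| ^ p + |b| ^ p - p * (|a| ^ (p - 1) * SignType.sign a * b
      + |b| ^ (p - 1) * SignType.sign b * a) ≤ |a - b| ^ p := by
  have hp0 : p ≠ 0 := by linarith
  have hp1 : p - 1 ≠ 0 := by linarith
  have sameSign : ∀ x y : ℝ, 0 < x → 0 < y →
      x ^ p + y ^ p - p * (x ^ (p - 1) * y + y ^ (p - 1) * x) ≤ |x - y| ^ p := by
    intro x y hx hy
    rcases le_total y x with h | h
    · rw [abs_of_nonneg (sub_nonneg.2 h)]
      exact rpow_add_rpow_sub_mul_le_sub_rpow hp hy h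
    · rw [abs_of_nonpos (sub_nonpos.2 h), neg_sub]
      linarith [rpow_add_rpow_sub_mul_le_sub_rpow hp hx h]
  rcases lt_trichotomy a 0 with ha | rfl | ha
  · rcases lt_trichotomy b 0 with hb | rfl | hb
    · have h := sameSign (-a) (-b) (by linarith) (by linarith)
      rw [show -a - -b = -(a - b) by ring, abs_neg] at h
      simp only [abs_of_neg ha, abs_of_neg hb, sign_neg ha, sign_neg hb, SignType.coe_neg_one]
      linarith
    · simp [Real.zero_rpow hp0, Real.zero_rpow hp1]
    · have h := rpow_add_rpow_add_mul_add_mul_le_add_rpow hp (neg_pos.2 ha) hb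
      rw [abs_of_neg (by linarith : a - b < 0), show -(a - b) = -a + b by ring]
      simp only [abs_of_neg ha, abs_of_pos hb, sign_neg ha, sign_pos hb, SignType.coe_neg_one,
        SignType.coe_one]
      linarith
  · simp [Real.zero_rpow hp0, Real.zero_rpow hp1]
  · rcases lt_trichotomy b 0 with hb | rfl | hb
    · have h := rpow_add_rpow_add_mul_add_mul_le_add_rpow hp ha (neg_pos.2 hb)
      rw [abs_of_pos (by linarith : 0 < a - b), show a - b = a + -b from sub_eq_add_neg a b]
      simp only [abs_of_pos ha, abs_of_neg hb, sign_pos ha, sign_neg hb, SignType.coe_neg_one,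
        SignType.coe_one]
      linarith
    · simp [Real.zero_rpow hp0, Real.zero_rpow hp1]
    · have h := sameSign a b ha hb
      simp only [abs_of_pos ha, abs_of_pos hb, sign_pos ha, sign_pos hb, SignType.coe_one]
      linarith

theorem two_mul_sum_abs_rpow_le_of_three_le {p : ℝ} (hp : 3 ≤ p) {ι : Type*} [Fintype ι]
    {α a : ι → ℝ} (hα : ∀ i, 0 ≤ α i) (hsum : ∑ i, α i = 1) (hmean : ∑ i, α i * a i = 0) :
    2 * ∑ i, α i * |a i| ^ p ≤ ∑ i, ∑ j, α i * α j * |a i - a j| ^ p := by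
  have lower : ∑ i, ∑ j, α i * α j * (|a i| ^ p + |a j| ^ p
      - p * (|a i| ^ (p - 1) * SignType.sign (a i) * a j
        + |a j| ^ (p - 1) * SignType.sign (a j) * a i)) ≤
      ∑ i, ∑ j, α i * α j * |a i - a j| ^ p := by
    gcongr with i _ j _
    · exact mul_nonneg (hα i) (hα j)
    · exact abs_rpow_add_abs_rpow_sub_le_abs_sub_rpow hp _ _
  refine le_trans (le_of_eq ?_) lower
  have expand : ∀ i j, α i * α j * (|a i| ^ p + |a j| ^ p
      - p * (|a i| ^ (p - 1) * SignType.sign (a i) * a j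
        + |a j| ^ (p - 1) * SignType.sign (a j) * a i)) =
      (α i * |a i| ^ p) * α j + α i * (α j * |a j| ^ p)
      - (p * α i * |a i| ^ (p - 1) * SignType.sign (a i)) * (α j * a j)
      - (α i * a i) * (p * α j * |a j| ^ (p - 1) * SignType.sign (a j)) := by
    intros; ring
  simp only [expand, Finset.sum_sub_distrib, Finset.sum_add_distrib, ← Finset.mul_sum,
    ← Finset.sum_mul, hsum, hmean]
  ring

theorem cos_sub_one_add_nonneg (u : ℝ) : 0 ≤ Real.cos u - 1 + u ^ 2 / 2 := by
  linarith [Real.one_sub_sq_div_two_le_cos (x := u)]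

theorem integrableOn_cos_kernel {p : ℝ} (hp : 2 < p) (hp4 : p < 4) :
    MeasureTheory.IntegrableOn
      (fun t : ℝ => (Real.cos t - 1 + t ^ 2 / 2) * t ^ (-p - 1)) (Set.Ioi 0) := by
  have hmeas : Measurable (fun t : ℝ => (Real.cos t - 1 + t ^ 2 / 2) * t ^ (-p - 1)) := by
    fun_prop
  rw [← Set.Ioc_union_Ioi_eq_Ioi (zero_le_one (α := ℝ))]
  refine MeasureTheory.IntegrableOn.union ?_ ?_
  · have hint : MeasureTheory.IntegrableOn (fun t : ℝ => t ^ (3 - p)) (Set.Ioc 0 1) :=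
      (intervalIntegrable_iff_integrableOn_Ioc_of_le zero_le_one).1
        (intervalIntegral.intervalIntegrable_rpow' (by linarith))
    refine MeasureTheory.Integrable.mono' hint hmeas.aestronglyMeasurable ?_
    refine (MeasureTheory.ae_restrict_iff' measurableSet_Ioc).2 (.of_forall fun t ht => ?_)
    have ht0 : 0 < t := ht.1
    rw [Real.norm_eq_abs, abs_of_nonneg
      (mul_nonneg (cos_sub_one_add_nonneg t) (Real.rpow_nonneg ht0.le _))]
    have hb := (abs_le.1 (Real.cos_bound (x := t) (by rw [abs_of_pos ht0]; exact ht.2))).2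
    rw [abs_of_pos ht0] at hb
    calc (Real.cos t - 1 + t ^ 2 / 2) * t ^ (-p - 1) ≤ t ^ (4 : ℕ) * t ^ (-p - 1) := by
          gcongr
          nlinarith [pow_pos ht0 4]
      _ = t ^ (3 - p) := by
          rw [← Real.rpow_natCast, ← Real.rpow_add ht0]
          norm_num
          ring_nf
  · refine MeasureTheory.Integrable.mono'
      (integrableOn_Ioi_rpow_of_lt (a := 1 - p) (by linarith) zero_lt_one)
      hmeas.aestronglyMeasurable ?_
    refine (MeasureTheory.ae_restrict_iff' measurableSet_Ioi).2 (.of_forall fun t ht => ?_)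
    have ht0 : 0 < t := zero_lt_one.trans ht
    rw [Real.norm_eq_abs, abs_of_nonneg
      (mul_nonneg (cos_sub_one_add_nonneg t) (Real.rpow_nonneg ht0.le _))]
    calc (Real.cos t - 1 + t ^ 2 / 2) * t ^ (-p - 1) ≤ t ^ (2 : ℕ) * t ^ (-p - 1) := by
          gcongr
          nlinarith [Real.cos_le_one t]
      _ = t ^ (1 - p) := by
          rw [← Real.rpow_natCast, ← Real.rpow_add ht0]
          norm_num
          ring_nf

theorem cos_kernel_comp_mul {p x t : ℝ} (hx : 0 < x) (ht : 0 < t) :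
    (Real.cos (x * t) - 1 + (x * t) ^ 2 / 2) * t ^ (-p - 1) =
      x ^ (p + 1) * ((Real.cos (x * t) - 1 + (x * t) ^ 2 / 2) * (x * t) ^ (-p - 1)) := by
  have h : x ^ (p + 1) * x ^ (-p - 1) = 1 := by
    rw [← Real.rpow_add hx]
    ring_nf
    simp
  rw [Real.mul_rpow hx.le ht.le]
  linear_combination (-(Real.cos (x * t) - 1 + (x * t) ^ 2 / 2) * t ^ (-p - 1)) * h

theorem cos_kernel_abs (x t : ℝ) :
    Real.cos (|x| * t) - 1 + (|x| * t) ^ 2 / 2 = Real.cos (x * t) - 1 + (x * t) ^ 2 / 2 := by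
  rcases abs_choice x with h | h <;> simp [h]

theorem integrableOn_cos_kernel_comp_mul {p : ℝ} (hp : 2 < p) (hp4 : p < 4) (x : ℝ) :
    MeasureTheory.IntegrableOn
      (fun t : ℝ => (Real.cos (x * t) - 1 + (x * t) ^ 2 / 2) * t ^ (-p - 1)) (Set.Ioi 0) := by
  rcases eq_or_ne x 0 with rfl | hx
  · simp
  · have hx' : 0 < |x| := abs_pos.2 hx
    have h := (MeasureTheory.integrableOn_Ioi_comp_mul_left_iff
      (fun t : ℝ => (Real.cos t - 1 + t ^ 2 / 2) * t ^ (-p - 1)) 0 hx').2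
      (by simpa using integrableOn_cos_kernel hp hp4)
    refine MeasureTheory.IntegrableOn.congr_fun (h.const_mul (|x| ^ (p + 1))) (fun t ht => ?_) measurableSet_Ioi
    rw [← cos_kernel_abs x t]
    exact (cos_kernel_comp_mul hx' ht).symm

theorem integral_cos_kernel_comp_mul {p : ℝ} (hp : 2 < p) (x : ℝ) :
    ∫ t in Set.Ioi (0 : ℝ), (Real.cos (x * t) - 1 + (x * t) ^ 2 / 2) * t ^ (-p - 1) =
      |x| ^ p * ∫ t in Set.Ioi (0 : ℝ), (Real.cos t - 1 + t ^ 2 / 2) * t ^ (-p - 1) := by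
  rcases eq_or_ne x 0 with rfl | hx
  · simp [Real.zero_rpow (by linarith : p ≠ 0)]
  · have hx' : 0 < |x| := abs_pos.2 hx
    have h := MeasureTheory.integral_comp_mul_left_Ioi
      (fun t : ℝ => (Real.cos t - 1 + t ^ 2 / 2) * t ^ (-p - 1)) 0 hx'
    rw [MeasureTheory.setIntegral_congr_fun (g := fun t : ℝ => |x| ^ (p + 1) *
      ((Real.cos (|x| * t) - 1 + (|x| * t) ^ 2 / 2) * (|x| * t) ^ (-p - 1))) measurableSet_Ioi
      (fun t ht => by
        rw [← cos_kernel_abs x t]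
        exact cos_kernel_comp_mul hx' ht),
      MeasureTheory.integral_const_mul, h, mul_zero, smul_eq_mul,
      Real.rpow_add_one hx'.ne', mul_assoc, mul_inv_cancel_left₀ hx'.ne']

theorem integral_cos_kernel_pos {p : ℝ} (hp : 2 < p) (hp4 : p < 4) :
    0 < ∫ t in Set.Ioi (0 : ℝ), (Real.cos t - 1 + t ^ 2 / 2) * t ^ (-p - 1) := by
  rw [MeasureTheory.setIntegral_pos_iff_support_of_nonneg_ae
    ((MeasureTheory.ae_restrict_iff' measurableSet_Ioi).2 (.of_forall fun t ht =>
      mul_nonneg (cos_sub_one_add_nonneg t) (Real.rpow_nonneg (le_of_lt ht) _)))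
    (integrableOn_cos_kernel hp hp4)]
  refine lt_of_lt_of_le ?_ (MeasureTheory.measure_mono (s := Set.Ioi (0 : ℝ)) fun t ht => ?_)
  · simp
  · have ht0 : 0 < t := ht
    exact ⟨(mul_pos (by linarith [Real.one_sub_sq_div_two_lt_cos ht0.ne'])
      (Real.rpow_pos_of_pos ht0 _)).ne', ht⟩

theorem two_mul_sum_cos_kernel_le {ι : Type*} [Fintype ι] {α a : ι → ℝ}
    (hsum : ∑ i, α i = 1) (hmean : ∑ i, α i * a i = 0) (t : ℝ) :
    2 * ∑ i, α i * (Real.cos (a i * t) - 1 + (a i * t) ^ 2 / 2) ≤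
      ∑ i, ∑ j, α i * α j *
        (Real.cos ((a i - a j) * t) - 1 + ((a i - a j) * t) ^ 2 / 2) := by
  have expand : ∀ i j, α i * α j *
      (Real.cos ((a i - a j) * t) - 1 + ((a i - a j) * t) ^ 2 / 2) =
      (α i * Real.cos (a i * t)) * (α j * Real.cos (a j * t))
      + (α i * Real.sin (a i * t)) * (α j * Real.sin (a j * t)) - α i * α j
      + (t ^ 2 / 2 * (α i * a i ^ 2)) * α j + α i * (t ^ 2 / 2 * (α j * a j ^ 2))
      - t ^ 2 * (α i * a i) * (α j * a j) := by
    intro i j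
    rw [sub_mul, Real.cos_sub]
    ring
  have expand' : ∀ i, α i * (Real.cos (a i * t) - 1 + (a i * t) ^ 2 / 2) =
      α i * Real.cos (a i * t) - α i + t ^ 2 / 2 * (α i * a i ^ 2) := by
    intros; ring
  simp only [expand, expand', Finset.sum_sub_distrib, Finset.sum_add_distrib, ← Finset.mul_sum,
    ← Finset.sum_mul, hsum, hmean]
  nlinarith [sq_nonneg (∑ i, α i * Real.cos (a i * t) - 1),
    sq_nonneg (∑ i, α i * Real.sin (a i * t))]

theorem two_mul_sum_abs_rpow_le_of_lt_four {p : ℝ} (hp : 2 < p) (hp4 : p < 4) {ι : Type*}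
    [Fintype ι] {α a : ι → ℝ} (hsum : ∑ i, α i = 1) (hmean : ∑ i, α i * a i = 0) :
    2 * ∑ i, α i * |a i| ^ p ≤ ∑ i, ∑ j, α i * α j * |a i - a j| ^ p := by
  set K : ℝ → ℝ → ℝ := fun x t => (Real.cos (x * t) - 1 + (x * t) ^ 2 / 2) * t ^ (-p - 1)
    with hK
  have hint : ∀ x, MeasureTheory.IntegrableOn (K x) (Set.Ioi 0) :=
    integrableOn_cos_kernel_comp_mul hp hp4
  set c := ∫ t in Set.Ioi (0 : ℝ), (Real.cos t - 1 + t ^ 2 / 2) * t ^ (-p - 1)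
  have hval : ∀ x, ∫ t in Set.Ioi (0 : ℝ), K x t = |x| ^ p * c :=
    integral_cos_kernel_comp_mul hp
  have hc0 : 0 < c := integral_cos_kernel_pos hp hp4
  have hle : ∫ t in Set.Ioi (0 : ℝ), 2 * ∑ i, α i * K (a i) t ≤
      ∫ t in Set.Ioi (0 : ℝ), ∑ i, ∑ j, α i * α j * K (a i - a j) t := by
    refine MeasureTheory.setIntegral_mono_on ?_ ?_ measurableSet_Ioi fun t ht => ?_
    · exact (MeasureTheory.integrable_finsetSum _ fun i _ => (hint _).const_mul _).const_mul _
    · exact MeasureTheory.integrable_finsetSum _ fun i _ =>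
        MeasureTheory.integrable_finsetSum _ fun j _ => (hint _).const_mul _
    · have h := mul_le_mul_of_nonneg_right (two_mul_sum_cos_kernel_le hsum hmean t)
        (Real.rpow_nonneg (le_of_lt ht) (-p - 1))
      simpa only [hK, mul_assoc, Finset.sum_mul] using h
  rw [MeasureTheory.integral_const_mul,
    MeasureTheory.integral_finsetSum _ fun i _ => (hint _).const_mul _,
    MeasureTheory.integral_finsetSum _ fun i _ =>
      MeasureTheory.integrable_finsetSum _ fun j _ => (hint _).const_mul _] at hle
  simp_rw [MeasureTheory.integral_finsetSum Finset.univ fun j _ =>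
    (hint (a _ - a j)).const_mul (α _ * α j), MeasureTheory.integral_const_mul, hval,
    ← mul_assoc, ← Finset.sum_mul] at hle
  rw [← mul_assoc] at hle
  exact le_of_mul_le_mul_right hle hc0

theorem two_mul_sum_abs_sub_mean_rpow_le {p : ℝ} (hp : 2 < p) {ι : Type*} [Fintype ι]
    {α : ι → ℝ} (x : ι → ℝ) (hα : ∀ i, 0 ≤ α i) (hsum : ∑ i, α i = 1) :
    2 * ∑ i, α i * |x i - ∑ j, α j * x j| ^ p ≤ ∑ i, ∑ j, α i * α j * |x i - x j| ^ p := by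
  have hmean : ∑ i, α i * (x i - ∑ j, α j * x j) = 0 := by
    simp only [mul_sub, Finset.sum_sub_distrib, ← Finset.sum_mul, hsum, one_mul, sub_self]
  rcases lt_or_ge p 4 with h | h
  · simpa using two_mul_sum_abs_rpow_le_of_lt_four hp h hsum hmean
  · simpa using two_mul_sum_abs_rpow_le_of_three_le (by linarith) hα hsum hmean

theorem lp.two_mul_sum_norm_sub_mean_rpow_le {p : ℝ} (hp : 2 < p)
    [Fact (1 ≤ ENNReal.ofReal p)] {ι : Type*} [Fintype ι] {α : ι → ℝ}
    (y : ι → lp (fun _ : ℕ => ℝ) (ENNReal.ofReal p)) (hα : ∀ i, 0 ≤ α i)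
    (hsum : ∑ i, α i = 1) :
    2 * ∑ i, α i * ‖y i - ∑ j, α j • y j‖ ^ p ≤ ∑ i, ∑ j, α i * α j * ‖y i - y j‖ ^ p := by
  have htop : (ENNReal.ofReal p).toReal = p := ENNReal.toReal_ofReal (by linarith)
  have hnorm : ∀ z : lp (fun _ : ℕ => ℝ) (ENNReal.ofReal p),
      HasSum (fun k => |z k| ^ p) (‖z‖ ^ p) := fun z => by
    have h := lp.hasSum_norm (by rw [htop]; linarith) z
    simpa only [htop, Real.norm_eq_abs] using h
  refine hasSum_le (fun k => ?_)
    ((hasSum_sum fun i _ => (hnorm (y i - ∑ j, α j • y j)).mul_left (α i)).mul_left 2)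
    (hasSum_sum fun i _ => hasSum_sum fun j _ => (hnorm (y i - y j)).mul_left (α i * α j))
  have hcoe : (∑ j, α j • y j : lp (fun _ : ℕ => ℝ) (ENNReal.ofReal p)) k
      = ∑ j, α j * y j k := by
    rw [lp.coeFn_sum, Finset.sum_apply]
    rfl
  simpa only [lp.coeFn_sub, Pi.sub_apply, hcoe] using
    two_mul_sum_abs_sub_mean_rpow_le hp (fun i => y i k) hα hsum

/-- A finite family of convex functions whose pointwise maximum is at least `R` everywhere has a
convex combination that is at least `R` everywhere. -/
theorem exists_weights_le_sum_of_convexOn {E ι : Type*} [AddCommGroup E] [Module ℝ E]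
    [Nonempty E] [Fintype ι] {f : ι → E → ℝ} (hf : ∀ i, ConvexOn ℝ Set.univ (f i)) {R : ℝ}
    (hR : ∀ z, ∃ i, R ≤ f i z) :
    ∃ w : ι → ℝ, (∀ i, 0 ≤ w i) ∧ ∑ i, w i = 1 ∧ ∀ z, R ≤ ∑ i, w i * f i z := by
  classical
  set S : Set (ι → ℝ) := {v | ∃ z, ∀ i, f i z ≤ v i}
  set T : Set (ι → ℝ) := Set.univ.pi fun _ => Set.Iio R
  have hSconv : Convex ℝ S := by
    rintro v ⟨z, hz⟩ v' ⟨z', hz'⟩ s s' hs hs' hss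
    refine ⟨s • z + s' • z', fun i => ?_⟩
    refine ((hf i).2 (Set.mem_univ z) (Set.mem_univ z') hs hs' hss).trans ?_
    simp only [Pi.add_apply, Pi.smul_apply, smul_eq_mul]
    gcongr
    · exact hz i
    · exact hz' i
  have hdisj : Disjoint T S := by
    rw [Set.disjoint_left]
    rintro v hv ⟨z, hz⟩
    obtain ⟨i, hi⟩ := hR z
    exact absurd (hi.trans (hz i)) (not_le.2 (hv i (Set.mem_univ i)))
  obtain ⟨g, u, hgT, hgS⟩ := geometric_hahn_banach_open
    (convex_pi fun _ _ => convex_Iio R) (isOpen_set_pi Set.finite_univ fun _ _ => isOpen_Iio)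
    hSconv hdisj
  set w : ι → ℝ := fun i => g (Pi.single i 1) with hw
  have hg : ∀ v, g v = ∑ i, w i * v i := fun v => by
    conv_lhs => rw [pi_eq_sum_univ' v]
    simp [hw, mul_comm, Pi.single, map_sum]
  obtain ⟨z₀⟩ := ‹Nonempty E›
  have hw0 : ∀ i, 0 ≤ w i := by
    intro i
    by_contra! hi
    set b : ι → ℝ := fun j => f j z₀ with hb
    set s : ℝ := (g b - u + 1) / (-w i) with hs
    have hub : u ≤ g b := hgS b ⟨z₀, fun _ => le_rfl⟩
    have hs0 : 0 ≤ s := div_nonneg (by linarith) (by linarith)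
    have hmem : b + s • Pi.single i 1 ∈ S := ⟨z₀, fun j => by
      have : (0 : ℝ) ≤ (Pi.single i (1 : ℝ) : ι → ℝ) j := by
        by_cases h : j = i
        · subst h; simp
        · simp [h]
      simp only [Pi.add_apply, Pi.smul_apply, smul_eq_mul, hb]
      nlinarith [mul_nonneg hs0 this]⟩
    have h := hgS _ hmem
    rw [map_add, map_smul, smul_eq_mul] at h
    have hsw : s * w i = -(g b - u + 1) := by
      rw [hs]
      field_simp [hi.ne]
    change u ≤ g b + s * w i at h
    linarith
  have hlt : ∀ ε > 0, (R - ε) * ∑ i, w i < u := fun ε hε => by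
    have h := hgT (fun _ => R - ε) fun i _ => by simp [hε]
    rwa [hg, ← Finset.sum_mul, mul_comm] at h
  have hle : ∀ z, u ≤ ∑ i, w i * f i z := fun z => by
    rw [← hg fun i => f i z]
    exact hgS _ ⟨z, fun _ => le_rfl⟩
  have hW0 : 0 ≤ ∑ i, w i := Finset.sum_nonneg fun i _ => hw0 i
  have hW : 0 < ∑ i, w i := by
    refine hW0.lt_of_ne fun h => ?_
    have hzero : ∀ i, w i = 0 := fun i =>
      (Finset.sum_eq_zero_iff_of_nonneg fun i _ => hw0 i).1 h.symm i (Finset.mem_univ i)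
    have h₁ := hlt 1 one_pos
    have h₂ := hle z₀
    simp only [hzero, zero_mul, Finset.sum_const_zero, mul_zero] at h₁ h₂
    linarith
  have hRu : R * ∑ i, w i ≤ u := by
    refine le_of_forall_pos_lt_add fun δ hδ => ?_
    have h := hlt (δ / ∑ i, w i) (div_pos hδ hW)
    rw [sub_mul, div_mul_cancel₀ _ hW.ne'] at h
    linarith
  refine ⟨fun i => w i / ∑ j, w j, fun i => div_nonneg (hw0 i) hW0, ?_, fun z => ?_⟩
  · rw [← Finset.sum_div, div_self hW.ne']
  · simp only [div_mul_eq_mul_div]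
    rw [← Finset.sum_div, le_div_iff₀ hW]
    exact hRu.trans (hle z)

theorem exists_chebRadius_le_norm_sub_s8 {p : ℝ≥0∞} [Fact (1 ≤ p)]
    {A : Set (lp (fun _ : ℕ => ℝ) p)} (hfin : A.Finite) (hne : A.Nonempty)
    (z : lp (fun _ : ℕ => ℝ) p) : ∃ x : A, chebRadius A ≤ ‖(x : lp (fun _ : ℕ => ℝ) p) - z‖ := by
  have := hfin.to_subtype
  have := hne.to_subtype
  obtain ⟨x, hx⟩ := exists_eq_ciSup_of_finite
    (f := fun x : A => ‖(x : lp (fun _ : ℕ => ℝ) p) - z‖)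
  refine ⟨x, hx ▸ ciInf_le ⟨0, ?_⟩ z⟩
  rintro _ ⟨y, rfl⟩
  exact Real.iSup_nonneg fun _ => norm_nonneg _

theorem radius_le_double_sum_large_p (p : ℝ) (hp : 2 < p)
    [Fact (1 ≤ ENNReal.ofReal p)]
    (A : Set (lp (fun _ : ℕ => ℝ) (ENNReal.ofReal p)))
    (hfin : A.Finite) (hne : A.Nonempty) (hr : 0 < chebRadius A) :
    ∃ (m : ℕ) (y : Fin m → lp (fun _ : ℕ => ℝ) (ENNReal.ofReal p)) (α : Fin m → ℝ),
      (∀ i, y i ∈ A) ∧ (∀ i, 0 < α i) ∧ (∑ i, α i = 1) ∧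
      2 * chebRadius A ^ p ≤ ∑ i, ∑ j, α i * α j * ‖y i - y j‖ ^ p := by
  have := hfin.to_subtype
  have := Fintype.ofFinite A
  have hconv : ∀ x : A, ConvexOn ℝ Set.univ
      fun z : lp (fun _ : ℕ => ℝ) (ENNReal.ofReal p) => ‖x.1 - z‖ ^ p := fun x => by
    have h : ConvexOn ℝ Set.univ
        fun z : lp (fun _ : ℕ => ℝ) (ENNReal.ofReal p) => ‖x.1 - z‖ := by
      simpa only [dist_eq_norm, norm_sub_rev] using convexOn_dist x.1 convex_univ
    refine ⟨convex_univ, fun z _ z' _ s s' hs hs' hss => ?_⟩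
    exact (Real.rpow_le_rpow (norm_nonneg _)
      (h.2 (Set.mem_univ z) (Set.mem_univ z') hs hs' hss) (by linarith)).trans
      ((convexOn_rpow (by linarith : 1 ≤ p)).2 (norm_nonneg _) (norm_nonneg _) hs hs' hss)
  obtain ⟨w, hw0, hw1, hw⟩ := exists_weights_le_sum_of_convexOn hconv
    (R := chebRadius A ^ p) fun z =>
      (exists_chebRadius_le_norm_sub_s8 hfin hne z).imp fun _ hx =>
        Real.rpow_le_rpow hr.le hx (by linarith)
  have key : 2 * chebRadius A ^ p ≤ ∑ i : A, ∑ j : A, w i * w j * ‖i.1 - j.1‖ ^ p :=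
    (mul_le_mul_of_nonneg_left (hw _) zero_le_two).trans
      (lp.two_mul_sum_norm_sub_mean_rpow_le hp (fun x : A => x.1) hw0 hw1)
  classical
  let e := Fintype.equivFin {x : A // 0 < w x}
  have hsum : ∀ F : A → ℝ, (∀ x, w x = 0 → F x = 0) →
      ∑ i, F (e.symm i).1 = ∑ x, F x := fun F hF => by
    rw [e.symm.sum_comp fun x => F x.1,
      ← Finset.sum_subtype (Finset.univ.filter fun x => 0 < w x) (by simp) F]
    exact Finset.sum_filter_of_ne fun x _ hx =>
      (hw0 x).lt_of_ne fun h => hx (hF x h.symm)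
  refine ⟨_, fun i => (e.symm i).1.1, fun i => w (e.symm i).1, fun i => (e.symm i).1.2,
    fun i => (e.symm i).2, ?_, ?_⟩
  · rw [hsum w fun _ h => h, hw1]
  · rw [hsum (fun x => ∑ j, w x * w (e.symm j).1 * ‖x.1 - (e.symm j).1.1‖ ^ p)
      fun x hx => by simp [hx]]
    refine key.trans_eq (Finset.sum_congr rfl fun x _ => ?_)
    exact (hsum (fun y => w x * w y * ‖x.1 - y.1‖ ^ p) fun y hy => by simp [hy]).symm
end

section
/- Let p be a real number with 1 < p ≤ 2 and let q = p/(p−1). Let A be a bounded subset of ℓ^p containing at least two points which is extremal, i.e. r(A) = 2^(−1/q) · d(A). Then for every ε with 0 < ε < d(A), there is no finite family D_1, …, D_m of subsets of ℓ^p with A ⊆ D_1 ∪ … ∪ D_m and d(D_i) ≤ d(A) − ε for every i. (Equivalently, the Kuratowski measure of noncompactness of A equals d(A).) -/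
open scoped ENNReal

open Finset

/-- The odd extension `sign a * |a| ^ s` of the power function. -/
noncomputable def oddRpow (s a : ℝ) : ℝ := max a 0 ^ s - max (-a) 0 ^ s

lemma oddRpow_neg (s a : ℝ) : oddRpow s (-a) = -oddRpow s a := by
  simp [oddRpow]

lemma oddRpow_of_nonneg {s a : ℝ} (hs : 0 < s) (ha : 0 ≤ a) : oddRpow s a = a ^ s := by
  simp [oddRpow, ha, Real.zero_rpow hs.ne']

lemma continuous_oddRpow {s : ℝ} (hs : 0 < s) : Continuous (oddRpow s) :=
  ((Real.continuous_rpow_const hs.le).comp (by fun_prop)).sub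
    ((Real.continuous_rpow_const hs.le).comp (by fun_prop))

lemma oddRpow_nonneg {s a : ℝ} (hs : 0 < s) (ha : 0 ≤ a) : 0 ≤ oddRpow s a := by
  rw [oddRpow_of_nonneg hs ha]
  positivity

lemma oddRpow_nonpos {s a : ℝ} (hs : 0 < s) (ha : a ≤ 0) : oddRpow s a ≤ 0 := by
  have := oddRpow_nonneg hs (neg_nonneg.2 ha)
  rw [oddRpow_neg] at this
  linarith

lemma rpow_mul_self_of_nonneg {s a : ℝ} (hs : 0 < s) (ha : 0 ≤ a) : a ^ s * a = a ^ (s + 1) := by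
  rw [Real.rpow_add_one' ha (by linarith)]

lemma oddRpow_mul_self {s : ℝ} (hs : 0 < s) (a : ℝ) : oddRpow s a * a = |a| ^ (s + 1) := by
  rcases le_total 0 a with ha | ha
  · rw [oddRpow_of_nonneg hs ha, abs_of_nonneg ha, rpow_mul_self_of_nonneg hs ha]
  · rw [← neg_neg a, oddRpow_neg, oddRpow_of_nonneg hs (neg_nonneg.2 ha), abs_neg,
      abs_of_nonneg (neg_nonneg.2 ha), ← rpow_mul_self_of_nonneg hs (neg_nonneg.2 ha)]
    ring

lemma rpow_sub_rpow_le {s a b : ℝ} (hs : 0 < s) (hs1 : s ≤ 1) (hb : 0 ≤ b) (hab : b ≤ a) :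
    a ^ s - b ^ s ≤ 2 ^ (1 - s) * (a - b) ^ s := by
  have h := Real.rpow_add_le_add_rpow (sub_nonneg.2 hab) hb hs.le hs1
  rw [sub_add_cancel] at h
  have h2 : (1 : ℝ) ≤ 2 ^ (1 - s) := Real.one_le_rpow (by norm_num) (by linarith)
  have h3 : 0 ≤ (a - b) ^ s := Real.rpow_nonneg (sub_nonneg.2 hab) s
  nlinarith

lemma rpow_add_rpow_le {s a b : ℝ} (hs : 0 < s) (hs1 : s ≤ 1) (ha : 0 ≤ a) (hb : 0 ≤ b) :
    a ^ s + b ^ s ≤ 2 ^ (1 - s) * (a + b) ^ s := by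
  have h := (Real.concaveOn_rpow hs.le hs1).2 (Set.mem_Ici.2 ha) (Set.mem_Ici.2 hb)
    (by norm_num : (0 : ℝ) ≤ 1 / 2) (by norm_num : (0 : ℝ) ≤ 1 / 2) (by norm_num)
  simp only [smul_eq_mul] at h
  rw [← mul_add, ← mul_add, Real.mul_rpow (by norm_num) (by positivity), one_div,
    Real.inv_rpow (by norm_num), inv_mul_le_iff₀ (by norm_num)] at h
  rwa [Real.rpow_sub (by norm_num), Real.rpow_one, div_eq_mul_inv, mul_assoc]

lemma oddRpow_sub_le {s a b : ℝ} (hs : 0 < s) (hs1 : s ≤ 1) (hab : b ≤ a) :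
    oddRpow s a - oddRpow s b ≤ 2 ^ (1 - s) * (a - b) ^ s := by
  rcases le_total 0 b with hb | hb
  · rw [oddRpow_of_nonneg hs hb, oddRpow_of_nonneg hs (hb.trans hab)]
    exact rpow_sub_rpow_le hs hs1 hb hab
  · have hb' := oddRpow_neg s b
    rw [oddRpow_of_nonneg hs (neg_nonneg.2 hb)] at hb'
    rcases le_total 0 a with ha | ha
    · have h := rpow_add_rpow_le hs hs1 ha (neg_nonneg.2 hb)
      rw [oddRpow_of_nonneg hs ha, sub_eq_add_neg, sub_eq_add_neg, ← hb']
      exact h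
    · have ha' := oddRpow_neg s a
      rw [oddRpow_of_nonneg hs (neg_nonneg.2 ha)] at ha'
      have h := rpow_sub_rpow_le hs hs1 (neg_nonneg.2 ha) (neg_le_neg hab)
      rw [ha', hb', neg_sub_neg, neg_sub_neg] at h
      exact h

lemma oddRpow_sub_mul_sub_le {s : ℝ} (hs : 0 < s) (hs1 : s ≤ 1) (a b : ℝ) :
    (oddRpow s a - oddRpow s b) * (a - b) ≤ 2 ^ (1 - s) * |a - b| ^ (s + 1) := by
  wlog hab : b ≤ a generalizing a b
  · have := this b a (le_of_not_ge hab)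
    rw [abs_sub_comm]
    linarith
  · have h := mul_le_mul_of_nonneg_right (oddRpow_sub_le hs hs1 hab) (sub_nonneg.2 hab)
    rw [mul_assoc, rpow_mul_self_of_nonneg hs (sub_nonneg.2 hab)] at h
    rwa [abs_of_nonneg (sub_nonneg.2 hab)]

/-- A weighted family of reals has an `L ^ (s + 1)` mean. -/
lemma exists_sum_oddRpow_sub_eq_zero {ι : Type*} [Fintype ι] {s : ℝ} (hs : 0 < s) {t : ι → ℝ}
    (ht : ∀ i, 0 ≤ t i) (a : ι → ℝ) : ∃ y, ∑ i, t i * oddRpow s (a i - y) = 0 := by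
  have hc : Continuous fun y => ∑ i, t i * oddRpow s (a i - y) :=
    continuous_finsetSum _ fun i _ =>
      continuous_const.mul ((continuous_oddRpow hs).comp (by fun_prop))
  have hle : ∀ i, |a i| ≤ ∑ j, |a j| := fun i =>
    single_le_sum (f := fun j => |a j|) (fun j _ => abs_nonneg _) (mem_univ i)
  refine mem_range_of_exists_le_of_exists_ge hc ⟨∑ j, |a j|, ?_⟩ ⟨-∑ j, |a j|, ?_⟩
  · refine sum_nonpos fun i _ => mul_nonpos_of_nonneg_of_nonpos (ht i) (oddRpow_nonpos hs ?_)
    linarith [hle i, le_abs_self (a i)]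
  · refine sum_nonneg fun i _ => mul_nonneg (ht i) (oddRpow_nonneg hs ?_)
    linarith [hle i, neg_abs_le (a i)]

lemma exists_sum_abs_sub_rpow_le {ι : Type*} [Fintype ι] {p : ℝ} (hp1 : 1 < p) (hp2 : p ≤ 2)
    {t : ι → ℝ} (ht : ∀ i, 0 ≤ t i) (ht1 : ∑ i, t i = 1) (a : ι → ℝ) :
    ∃ y, ∑ i, t i * |a i - y| ^ p ≤ 2 ^ (1 - p) * ∑ i, ∑ j, t i * t j * |a i - a j| ^ p := by
  obtain ⟨s, rfl⟩ : ∃ s, p = s + 1 := ⟨p - 1, by ring⟩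
  have hs : 0 < s := by linarith
  obtain ⟨y, hy⟩ := exists_sum_oddRpow_sub_eq_zero hs ht a
  refine ⟨y, ?_⟩
  obtain ⟨b, hb⟩ : ∃ b : ι → ℝ, ∀ i, b i = a i - y := ⟨_, fun _ => rfl⟩
  simp only [← hb] at hy ⊢
  have hsum : ∑ i, ∑ j, t i * t j * ((oddRpow s (b i) - oddRpow s (b j)) * (b i - b j)) =
      2 * ∑ i, t i * |b i| ^ (s + 1) := by
    have hexp : ∀ i j, t i * t j * ((oddRpow s (b i) - oddRpow s (b j)) * (b i - b j)) =
        (t i * |b i| ^ (s + 1)) * t j + t i * (t j * |b j| ^ (s + 1))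
          - (t i * oddRpow s (b i)) * (t j * b j) - (t i * b i) * (t j * oddRpow s (b j)) := by
      intro i j
      rw [← oddRpow_mul_self hs, ← oddRpow_mul_self hs]
      ring
    simp only [hexp, sum_sub_distrib, sum_add_distrib, ← mul_sum, ← sum_mul, ht1, hy]
    ring
  have hle : ∑ i, ∑ j, t i * t j * ((oddRpow s (b i) - oddRpow s (b j)) * (b i - b j)) ≤
      ∑ i, ∑ j, t i * t j * (2 ^ (1 - s) * |a i - a j| ^ (s + 1)) := by
    refine sum_le_sum fun i _ => sum_le_sum fun j _ =>
      mul_le_mul_of_nonneg_left ?_ (mul_nonneg (ht i) (ht j))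
    have := oddRpow_sub_mul_sub_le hs (by linarith) (b i) (b j)
    rwa [show b i - b j = a i - a j by simp [hb]] at this ⊢
  have h2 : (2 : ℝ) ^ (1 - s) = 2 * 2 ^ (1 - (s + 1)) := by
    rw [show 1 - s = (1 - (s + 1)) + 1 by ring, Real.rpow_add_one (by norm_num)]
    ring
  have hfac : ∑ i, ∑ j, t i * t j * (2 ^ (1 - s) * |a i - a j| ^ (s + 1)) =
      2 * (2 ^ (1 - (s + 1)) * ∑ i, ∑ j, t i * t j * |a i - a j| ^ (s + 1)) := by
    rw [h2]
    simp only [mul_sum]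
    exact sum_congr rfl fun i _ => sum_congr rfl fun j _ => by ring
  linarith

/-- Finite minimax alternative for convex functions. -/
lemma exists_forall_le_of_forall_weights {ι E : Type*} [Fintype ι] [AddCommGroup E]
    [Module ℝ E] {f : ι → E → ℝ} (hf : ∀ i, ConvexOn ℝ Set.univ (f i)) {M M' : ℝ} (hM : M < M')
    (h : ∀ t : ι → ℝ, (∀ i, 0 ≤ t i) → ∑ i, t i = 1 → ∃ y, ∑ i, t i * f i y ≤ M) :
    ∃ y, ∀ i, f i y ≤ M' := by
  classical
  by_contra hno
  set C : Set (ι → ℝ) := {v | ∃ y, ∀ i, f i y < v i} with hC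
  have hconv : Convex ℝ C := by
    rintro v ⟨y, hy⟩ w ⟨z, hz⟩ a b ha hb hab
    refine ⟨a • y + b • z, fun i => ((hf i).2 trivial trivial ha hb hab).trans_lt ?_⟩
    simp only [Pi.add_apply, Pi.smul_apply, smul_eq_mul]
    rcases ha.eq_or_lt with rfl | ha
    · obtain rfl : b = 1 := by linarith
      simpa using hz i
    · have := mul_lt_mul_of_pos_left (hy i) ha
      have := mul_le_mul_of_nonneg_left (hz i).le hb
      linarith
  have hopen : IsOpen C := by
    have : C = ⋃ y, ⋂ i, {v | f i y < v i} := by ext; simp [hC]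
    rw [this]
    exact isOpen_iUnion fun y => isOpen_iInter_of_finite fun i =>
      isOpen_lt continuous_const (continuous_apply i)
  have hx : (fun _ => M') ∉ C := fun ⟨y, hy⟩ => hno ⟨y, fun i => (hy i).le⟩
  obtain ⟨g, hg⟩ := geometric_hahn_banach_open_point hconv hopen hx
  set t : ι → ℝ := fun i => -g (Pi.single i 1) with ht
  have hgt : ∀ v, g v = -∑ i, t i * v i := by
    intro v
    have := LinearMap.pi_apply_eq_sum_univ (g : (ι → ℝ) →ₗ[ℝ] ℝ) v
    simp only [ContinuousLinearMap.coe_coe, smul_eq_mul] at this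
    rw [this, ← sum_neg_distrib]
    refine sum_congr rfl fun i _ => ?_
    rw [ht, show (fun j => if i = j then (1 : ℝ) else 0) = Pi.single i 1 by
      ext j; simp [Pi.single_apply, eq_comm]]
    ring
  have hlt : ∀ v ∈ C, (∑ i, t i) * M' < ∑ i, t i * v i := by
    intro v hv
    have := hg v hv
    rw [hgt, hgt, ← sum_mul] at this
    linarith
  have hmem : ∀ (y : E) (η : ℝ), 0 < η → (fun i => f i y + η) ∈ C := fun y η hη =>
    ⟨y, fun i => by linarith⟩
  have ht0 : ∀ i, 0 ≤ t i := by
    intro i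
    by_contra! hi
    set S := ∑ j, t j * (f j 0 + 1) with hS
    set c := max 0 ((S - (∑ j, t j) * M') / (-t i))
    have hcmem : (fun j => f j 0 + 1 + c * (Pi.single i 1 : ι → ℝ) j) ∈ C := by
      refine ⟨0, fun j => ?_⟩
      have : 0 ≤ c * (Pi.single i 1 : ι → ℝ) j := by
        refine mul_nonneg (le_max_left _ _) ?_
        by_cases hij : j = i
        · subst hij; simp
        · simp [hij]
      linarith
    have h1 := hlt _ hcmem
    have h2 : ∑ j, t j * (f j 0 + 1 + c * (Pi.single i 1 : ι → ℝ) j) = S + c * t i := by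
      simp [mul_add _ (f _ 0 + 1), sum_add_distrib, Pi.single_apply, hS, mul_comm c]
    have h3 : (S - (∑ j, t j) * M') / (-t i) ≤ c := le_max_right _ _
    rw [div_le_iff₀ (by linarith)] at h3
    linarith
  have hT : 0 < ∑ i, t i := by
    refine (sum_nonneg fun i _ => ht0 i).lt_of_ne fun h0 => ?_
    have hz := (sum_eq_zero_iff_of_nonneg fun i _ => ht0 i).1 h0.symm
    have := hlt _ (hmem 0 1 one_pos)
    simp [hz] at this
  obtain ⟨y, hy⟩ := h (fun i => t i / ∑ j, t j) (fun i => div_nonneg (ht0 i) hT.le)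
    (by rw [← sum_div, div_self hT.ne'])
  have h1 := hlt _ (hmem y (M' - M) (by linarith))
  simp only [mul_add, sum_add_distrib, ← sum_mul] at h1
  simp only [div_mul_eq_mul_div] at hy
  rw [← sum_div, div_le_iff₀ hT] at hy
  linarith

lemma inv_card_le_sum_sum_ite {ι κ : Type*} [Fintype ι] [Fintype κ] [DecidableEq κ] [Nonempty κ]
    {t : ι → ℝ} (ht1 : ∑ i, t i = 1) (c : ι → κ) :
    (Fintype.card κ : ℝ)⁻¹ ≤ ∑ i, ∑ j, if c i = c j then t i * t j else 0 := by
  have hsum : ∑ k, ∑ i, (if c i = k then t i else 0) = 1 := by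
    rw [sum_comm]
    simpa using ht1
  have hsq : ∑ k, (∑ i, if c i = k then t i else 0) ^ 2 =
      ∑ i, ∑ j, if c i = c j then t i * t j else 0 := by
    simp only [sq, sum_mul_sum]
    rw [sum_comm]
    refine sum_congr rfl fun i _ => ?_
    rw [sum_comm]
    refine sum_congr rfl fun j _ => ?_
    simp [ite_mul, eq_comm]
  have h := sq_sum_le_card_mul_sum_sq (s := univ) (f := fun k => ∑ i, if c i = k then t i else 0)
  rw [hsum, hsq, card_univ, one_pow] at h
  rwa [inv_le_iff_one_le_mul₀' (by exact_mod_cast Fintype.card_pos)]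

lemma convexOn_norm_sub_rpow {E : Type*} [SeminormedAddCommGroup E] [NormedSpace ℝ E] {p : ℝ}
    (hp : 1 ≤ p) (x : E) : ConvexOn ℝ Set.univ fun y => ‖x - y‖ ^ p := by
  have hnorm : ConvexOn ℝ Set.univ fun y => ‖x - y‖ := by
    simpa only [dist_eq_norm'] using convexOn_univ_dist x
  refine ⟨convex_univ, fun y _ z _ a b ha hb hab => ?_⟩
  exact (Real.rpow_le_rpow (norm_nonneg _) (hnorm.2 trivial trivial ha hb hab)
    (by linarith)).trans ((convexOn_rpow hp).2 (norm_nonneg _) (norm_nonneg _) ha hb hab)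

lemma exists_lp_eq_of_memℓp_sub {P : ℝ≥0∞} (x : lp (fun _ : ℕ => ℝ) P) {z : ℕ → ℝ}
    (h : Memℓp (fun k => x k - z k) P) : ∃ w : lp (fun _ : ℕ => ℝ) P, ∀ k, w k = z k :=
  ⟨x - ⟨_, h⟩, fun k => sub_sub_cancel (x k) (z k)⟩

section Sequences

variable {P : ℝ≥0∞}

lemma exists_sum_norm_sub_rpow_le (hp1 : 1 < P.toReal) (hp2 : P.toReal ≤ 2) {ι : Type*} [Fintype ι]
    {t : ι → ℝ} (ht : ∀ i, 0 ≤ t i) (ht1 : ∑ i, t i = 1) (x : ι → lp (fun _ : ℕ => ℝ) P) :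
    ∃ y, ∑ i, t i * ‖x i - y‖ ^ P.toReal ≤
      2 ^ (1 - P.toReal) * ∑ i, ∑ j, t i * t j * ‖x i - x j‖ ^ P.toReal := by
  have hp0 : 0 < P.toReal := by linarith
  choose y hy using fun k => exists_sum_abs_sub_rpow_le hp1 hp2 ht ht1 (fun i => x i k)
  set B := 2 ^ (1 - P.toReal) * ∑ i, ∑ j, t i * t j * ‖x i - x j‖ ^ P.toReal
  have hB : ∀ S : Finset ℕ, ∑ k ∈ S, ∑ i, t i * |x i k - y k| ^ P.toReal ≤ B := by
    intro S
    refine (sum_le_sum fun k _ => hy k).trans ?_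
    rw [← mul_sum]
    refine mul_le_mul_of_nonneg_left ?_ (by positivity)
    rw [sum_comm]
    refine sum_le_sum fun i _ => ?_
    rw [sum_comm]
    refine sum_le_sum fun j _ => ?_
    rw [← mul_sum]
    exact mul_le_mul_of_nonneg_left (lp.sum_rpow_le_norm_rpow hp0 (x i - x j) S)
      (mul_nonneg (ht i) (ht j))
  obtain ⟨i₀, -, hi₀⟩ : ∃ i ∈ univ, 0 < t i :=
    exists_lt_of_sum_lt (f := fun _ => (0 : ℝ)) (by simp [ht1])
  have hmem : Memℓp (fun k => x i₀ k - y k) P := by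
    refine memℓp_gen' (C := B / t i₀) fun S => ?_
    rw [le_div_iff₀ hi₀, sum_mul]
    refine (sum_le_sum fun k _ => ?_).trans (hB S)
    rw [mul_comm]
    exact single_le_sum (f := fun i => t i * |x i k - y k| ^ P.toReal)
      (fun i _ => mul_nonneg (ht i) (by positivity)) (mem_univ i₀)
  obtain ⟨w, hw⟩ := exists_lp_eq_of_memℓp_sub (x i₀) hmem
  refine ⟨w, ?_⟩
  have hsum := hasSum_sum fun i (_ : i ∈ univ) =>
    (lp.hasSum_norm hp0 (x i - w)).mul_left (t i)
  refine hasSum_le_of_sum_le hsum fun S => ?_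
  simpa only [lp.coeFn_sub, Pi.sub_apply, hw, Real.norm_eq_abs] using hB S

variable [Fact (1 ≤ P)]

/-- A Jung-type bound for finite families split into classes of smaller diameter. -/
lemma exists_forall_norm_sub_rpow_le (hp1 : 1 < P.toReal) (hp2 : P.toReal ≤ 2) {ι κ : Type*}
    [Fintype ι] [Fintype κ] [Nonempty κ] (x : ι → lp (fun _ : ℕ => ℝ) P) (c : ι → κ)
    {d d' M : ℝ} (hd' : 0 ≤ d') (hdd' : d' ≤ d) (hx : ∀ i j, ‖x i - x j‖ ≤ d)
    (hxc : ∀ i j, c i = c j → ‖x i - x j‖ ≤ d')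
    (hM : 2 ^ (1 - P.toReal) *
      (d ^ P.toReal - (d ^ P.toReal - d' ^ P.toReal) * (Fintype.card κ : ℝ)⁻¹) < M) :
    ∃ y, ∀ i, ‖x i - y‖ ^ P.toReal ≤ M := by
  classical
  have hp0 : 0 ≤ P.toReal := by linarith
  refine exists_forall_le_of_forall_weights (fun i => convexOn_norm_sub_rpow hp1.le (x i)) hM
    fun t ht ht1 => ?_
  obtain ⟨y, hy⟩ := exists_sum_norm_sub_rpow_le hp1 hp2 ht ht1 x
  refine ⟨y, hy.trans (mul_le_mul_of_nonneg_left ?_ (by positivity))⟩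
  set e := d ^ P.toReal - d' ^ P.toReal with he
  have he0 : 0 ≤ e := sub_nonneg.2 (Real.rpow_le_rpow hd' hdd' hp0)
  have hpair : ∀ i j, t i * t j * ‖x i - x j‖ ^ P.toReal ≤
      t i * t j * d ^ P.toReal - e * (if c i = c j then t i * t j else 0) := by
    intro i j
    have htt := mul_nonneg (ht i) (ht j)
    split_ifs with hc
    · have := mul_le_mul_of_nonneg_left
        (Real.rpow_le_rpow (norm_nonneg _) (hxc i j hc) hp0) htt
      rw [he]
      linarith
    · have := mul_le_mul_of_nonneg_left (Real.rpow_le_rpow (norm_nonneg _) (hx i j) hp0) htt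
      linarith
  have h1 := sum_le_sum fun i (_ : i ∈ univ) => sum_le_sum fun j (_ : j ∈ univ) => hpair i j
  have h2 := mul_le_mul_of_nonneg_left (inv_card_le_sum_sum_ite ht1 c) he0
  simp only [sum_sub_distrib, ← mul_sum, ← sum_mul, ht1, mul_one, one_mul] at h1
  linarith

/-- Balls of a fixed radius in `ℓ^p` have the finite intersection property. -/
lemma exists_forall_norm_sub_le_of_finset (hp0 : 0 < P.toReal) {ι : Type*} [Nonempty ι]
    (x : ι → lp (fun _ : ℕ => ℝ) P) {R : ℝ} (hR : 0 ≤ R)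
    (h : ∀ F : Finset ι, ∃ y, ∀ i ∈ F, ‖x i - y‖ ≤ R) : ∃ y, ∀ i, ‖x i - y‖ ≤ R := by
  classical
  obtain ⟨i₀⟩ := ‹Nonempty ι›
  have hP0 : P ≠ 0 := fun h0 => by simp [h0] at hp0
  have hK : IsCompact (Set.pi Set.univ fun k => Set.Icc (x i₀ k - R) (x i₀ k + R)) :=
    isCompact_univ_pi fun k => isCompact_Icc
  obtain ⟨z, -, hz⟩ := hK.inter_iInter_nonempty
    (fun i => {z : ℕ → ℝ | ∀ S : Finset ℕ, ∑ k ∈ S, |x i k - z k| ^ P.toReal ≤ R ^ P.toReal})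
    (fun i => by
      simp only [Set.ofPred_forall]
      exact isClosed_iInter fun S => isClosed_le (continuous_finsetSum _ fun k _ =>
        (Real.continuous_rpow_const hp0.le).comp (by fun_prop)) continuous_const)
    (fun F => by
      obtain ⟨y, hy⟩ := h (insert i₀ F)
      refine ⟨y, fun k _ => ?_, ?_⟩
      · have h1 := (lp.norm_apply_le_norm hP0 (x i₀ - y) k).trans (hy i₀ (mem_insert_self _ _))
        have h2 : |x i₀ k - y k| ≤ R := h1
        rw [abs_le] at h2
        constructor <;> linarith
      · simp only [Set.mem_iInter]
        intro i hi S
        exact (lp.sum_rpow_le_norm_rpow hp0 (x i - y) S).trans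
          (Real.rpow_le_rpow (norm_nonneg _) (hy i (mem_insert_of_mem hi)) hp0.le))
  simp only [Set.mem_iInter] at hz
  have hmem : Memℓp (fun k => x i₀ k - z k) P := memℓp_gen' (hz i₀)
  obtain ⟨w, hw⟩ := exists_lp_eq_of_memℓp_sub (x i₀) hmem
  refine ⟨w, fun i => lp.norm_le_of_forall_sum_le hp0 hR fun S => ?_⟩
  simpa only [lp.coeFn_sub, Pi.sub_apply, hw, Real.norm_eq_abs] using hz i S

lemma chebRadius_le {A : Set (lp (fun _ : ℕ => ℝ) P)} (hA : A.Nonempty)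
    {y : lp (fun _ : ℕ => ℝ) P} {R : ℝ} (h : ∀ x ∈ A, ‖x - y‖ ≤ R) : chebRadius A ≤ R := by
  have := hA.to_subtype
  refine (ciInf_le ⟨0, ?_⟩ y).trans (ciSup_le fun x => h x x.2)
  rintro _ ⟨z, rfl⟩
  exact Real.iSup_nonneg fun _ => norm_nonneg _

end Sequences

theorem extremal_kuratowski_small_p (p q : ℝ) (hp1 : 1 < p) (hp2 : p ≤ 2)
    (hq : q = p / (p - 1)) [Fact (1 ≤ ENNReal.ofReal p)]
    (A : Set (lp (fun _ : ℕ => ℝ) (ENNReal.ofReal p)))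
    (hbdd : Bornology.IsBounded A)
    (htwo : ∃ a ∈ A, ∃ b ∈ A, a ≠ b)
    (hext : chebRadius A = 2 ^ (-(1 / q)) * Metric.diam A)
    (ε : ℝ) (hε0 : 0 < ε) (hε1 : ε < Metric.diam A) :
    ¬ ∃ (m : ℕ) (D : Fin m → Set (lp (fun _ : ℕ => ℝ) (ENNReal.ofReal p))),
        A ⊆ ⋃ i, D i ∧
        ∀ i, EMetric.diam (D i) ≤ ENNReal.ofReal (Metric.diam A - ε) := by
  rintro ⟨m, D, hcover, hD⟩
  have hpP : (ENNReal.ofReal p).toReal = p := ENNReal.toReal_ofReal (by linarith)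
  have hp0 : 0 < p := by linarith
  obtain ⟨a, ha, -⟩ := htwo
  have hA : A.Nonempty := ⟨a, ha⟩
  have := hA.to_subtype
  set d := Metric.diam A
  have hd0 : 0 < d := hε0.trans hε1
  choose c hc using fun x : A => Set.mem_iUnion.1 (hcover x.2)
  have : Nonempty (Fin m) := ⟨c ⟨a, ha⟩⟩
  have hm : (0 : ℝ) < Fintype.card (Fin m) := by exact_mod_cast Fintype.card_pos
  have hlt : (d - ε) ^ p < d ^ p := Real.rpow_lt_rpow (by linarith) (by linarith) hp0
  have h2 : (0 : ℝ) < 2 ^ (1 - p) := by positivity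
  obtain ⟨M, hM1, hM2⟩ : ∃ M, 2 ^ (1 - p) *
      (d ^ p - (d ^ p - (d - ε) ^ p) * (Fintype.card (Fin m) : ℝ)⁻¹) < M ∧
      M < 2 ^ (1 - p) * d ^ p := by
    refine exists_between (mul_lt_mul_of_pos_left ?_ h2)
    have := mul_pos (sub_pos.2 hlt) (inv_pos.2 hm)
    linarith
  have hM0 : 0 ≤ M := by
    refine le_trans (mul_nonneg h2.le ?_) hM1.le
    have h1 : (Fintype.card (Fin m) : ℝ)⁻¹ ≤ 1 :=
      inv_le_one_of_one_le₀ (by exact_mod_cast Fintype.card_pos)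
    have h3 := mul_le_mul_of_nonneg_left h1 (sub_pos.2 hlt).le
    have h4 : 0 ≤ (d - ε) ^ p := Real.rpow_nonneg (by linarith) p
    linarith
  obtain ⟨y, hy⟩ := exists_forall_norm_sub_le_of_finset (by rwa [hpP]) (fun x : A => x.1)
    (Real.rpow_nonneg hM0 p⁻¹) fun F => by
      obtain ⟨y, hy⟩ := exists_forall_norm_sub_rpow_le (by rwa [hpP]) (by rwa [hpP])
        (fun x : F => x.1.1) (fun x => c x.1) (d := d) (d' := d - ε) (M := M) (by linarith)
        (by linarith)
        (fun x z => by
          rw [← dist_eq_norm]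
          exact Metric.dist_le_diam_of_mem hbdd x.1.2 z.1.2)
        (fun x z hxz => by
          rw [← dist_eq_norm, ← edist_le_ofReal (by linarith)]
          exact (Metric.edist_le_ediam_of_mem (hc x.1) (hxz ▸ hc z.1)).trans (hD _))
        (by rwa [hpP])
      refine ⟨y, fun x hx => ?_⟩
      have h := hy ⟨x, hx⟩
      rw [hpP] at h
      exact (Real.le_rpow_inv_iff_of_pos (norm_nonneg _) hM0 hp0).2 h
  have hle := chebRadius_le hA fun x hx => hy ⟨x, hx⟩
  rw [hext] at hle
  have hpow : (2 ^ (-(1 / q)) * d) ^ p = 2 ^ (1 - p) * d ^ p := by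
    rw [Real.mul_rpow (by positivity) hd0.le, ← Real.rpow_mul (by norm_num), hq]
    congr 2
    have : p - 1 ≠ 0 := by linarith
    field_simp
    ring
  rw [Real.le_rpow_inv_iff_of_pos (by positivity) hM0 hp0, hpow] at hle
  linarith
end

section
/- Let p be a real number with p > 2. Let A be a bounded subset of ℓ^p containing at least two points which is extremal, i.e. r(A) = 2^(−1/p) · d(A). Then for every ε with 0 < ε < d(A), there is no finite family D_1, …, D_m of subsets of ℓ^p with A ⊆ D_1 ∪ … ∪ D_m and d(D_i) ≤ d(A) − ε for every i. (Equivalently, the Kuratowski measure of noncompactness of A equals d(A).) -/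
open scoped ENNReal

open MeasureTheory

theorem integrableOn_one_sub_cos_mul_rpow {q : ℝ} (hq0 : 0 < q) (hq2 : q < 2) (x : ℝ) :
    IntegrableOn (fun s : ℝ => (1 - Real.cos (x * s)) * s ^ (-1 - q)) (Set.Ioi 0) := by
  have hmeas : ∀ S : Set ℝ, AEStronglyMeasurable
      (fun s : ℝ => (1 - Real.cos (x * s)) * s ^ (-1 - q)) (volume.restrict S) := fun S =>
    Measurable.aestronglyMeasurable (by fun_prop)
  rw [← Set.Ioc_union_Ioi_eq_Ioi (zero_le_one' ℝ)]
  refine IntegrableOn.union ?_ ?_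
  · have h : IntegrableOn (fun s : ℝ => x ^ 2 / 2 * s ^ (1 - q)) (Set.Ioc 0 1) := by
      have := (intervalIntegral.intervalIntegrable_rpow' (a := 0) (b := 1)
        (show -1 < 1 - q by linarith)).1
      exact this.const_mul _
    refine Integrable.mono' h (hmeas _) ?_
    filter_upwards [ae_restrict_mem measurableSet_Ioc] with s hs
    have hs0 : 0 < s := hs.1
    rw [Real.norm_of_nonneg (mul_nonneg (by linarith [Real.cos_le_one (x * s)]) (by positivity))]
    have h2 : s ^ (1 - q) = s ^ 2 * s ^ (-1 - q) := by
      rw [← Real.rpow_natCast, ← Real.rpow_add hs0]; congr 1; push_cast; ring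
    rw [h2, ← mul_assoc]
    gcongr
    nlinarith [Real.one_sub_sq_div_two_le_cos (x := x * s)]
  · have h : IntegrableOn (fun s : ℝ => 2 * s ^ (-1 - q)) (Set.Ioi 1) :=
      (integrableOn_Ioi_rpow_of_lt (by linarith) one_pos).const_mul _
    refine Integrable.mono' h (hmeas _) ?_
    filter_upwards [ae_restrict_mem measurableSet_Ioi] with s hs
    have hs0 : 0 < s := one_pos.trans hs
    rw [Real.norm_of_nonneg (mul_nonneg (by linarith [Real.cos_le_one (x * s)]) (by positivity))]
    gcongr
    linarith [Real.neg_one_le_cos (x * s)]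

theorem integral_one_sub_cos_mul_rpow {q : ℝ} (hq0 : 0 < q) (x : ℝ) :
    ∫ s in Set.Ioi (0 : ℝ), (1 - Real.cos (x * s)) * s ^ (-1 - q) =
      |x| ^ q * ∫ s in Set.Ioi (0 : ℝ), (1 - Real.cos s) * s ^ (-1 - q) := by
  rcases eq_or_ne x 0 with rfl | hx
  · simp [Real.zero_rpow hq0.ne']
  have hx' : 0 < |x| := abs_pos.2 hx
  have key := integral_comp_mul_left_Ioi
    (fun s : ℝ => (1 - Real.cos s) * s ^ (-1 - q)) 0 hx'
  rw [mul_zero, smul_eq_mul] at key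
  have hI : ∫ s in Set.Ioi (0 : ℝ), (1 - Real.cos (x * s)) * s ^ (-1 - q) =
      |x| ^ (1 + q) * ∫ s in Set.Ioi (0 : ℝ), (1 - Real.cos (|x| * s)) * (|x| * s) ^ (-1 - q) := by
    rw [← integral_const_mul]
    refine setIntegral_congr_fun measurableSet_Ioi fun s hs => ?_
    have hs0 : (0 : ℝ) < s := hs
    have hc : Real.cos (|x| * s) = Real.cos (x * s) := by
      rw [← Real.cos_abs (x * s), abs_mul, abs_of_pos hs0]
    have hr : |x| ^ (1 + q) * |x| ^ (-1 - q) = 1 := by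
      rw [← Real.rpow_add hx']; simp
    simp only [hc, Real.mul_rpow hx'.le hs0.le]
    linear_combination -(1 - Real.cos (x * s)) * s ^ (-1 - q) * hr
  rw [hI, key, ← mul_assoc]
  congr 1
  rw [Real.rpow_add hx', Real.rpow_one]
  field_simp

theorem integral_one_sub_cos_mul_rpow_pos {q : ℝ} (hq0 : 0 < q) (hq2 : q < 2) :
    0 < ∫ s in Set.Ioi (0 : ℝ), (1 - Real.cos s) * s ^ (-1 - q) := by
  have hint := integrableOn_one_sub_cos_mul_rpow hq0 hq2 1
  simp only [one_mul] at hint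
  rw [setIntegral_pos_iff_support_of_nonneg_ae _ hint]
  · refine lt_of_lt_of_le ?_ (measure_mono (s := Set.Ioo (0 : ℝ) 1) ?_)
    · simp
    · intro s hs
      refine ⟨?_, hs.1⟩
      have hc : Real.cos s < 1 := by
        have := Real.cos_lt_cos_of_nonneg_of_le_pi le_rfl
          (by linarith [hs.2, Real.pi_gt_three] : s ≤ Real.pi) hs.1
        simpa using this
      have := Real.rpow_pos_of_pos hs.1 (-1 - q)
      simp only [Function.mem_support]
      exact mul_ne_zero (by linarith) this.ne'
  · filter_upwards [ae_restrict_mem measurableSet_Ioi] with s hs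
    exact mul_nonneg (by linarith [Real.cos_le_one s]) (Real.rpow_nonneg (le_of_lt hs) _)

/-- The kernel `|a|^q + |b|^q - |a - b|^q` is positive semidefinite for `0 < q < 2`. -/
theorem sum_mul_rpow_kernel_nonneg {ι : Type*} (s : Finset ι) {q : ℝ} (hq0 : 0 < q) (hq2 : q < 2)
    (t y : ι → ℝ) :
    0 ≤ ∑ i ∈ s, ∑ j ∈ s, t i * t j * (|y i| ^ q + |y j| ^ q - |y i - y j| ^ q) := by
  set C := ∫ s in Set.Ioi (0 : ℝ), (1 - Real.cos s) * s ^ (-1 - q) with hC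
  have hCpos : 0 < C := integral_one_sub_cos_mul_rpow_pos hq0 hq2
  let k : ℝ → ℝ → ℝ := fun x u => (1 - Real.cos (x * u)) * u ^ (-1 - q)
  have hk : ∀ x, Integrable (k x) (volume.restrict (Set.Ioi 0)) :=
    integrableOn_one_sub_cos_mul_rpow hq0 hq2
  have hkC : ∀ x, ∫ u in Set.Ioi (0 : ℝ), k x u = |x| ^ q * C :=
    integral_one_sub_cos_mul_rpow hq0
  have hterm : ∀ i j, C * (t i * t j * (|y i| ^ q + |y j| ^ q - |y i - y j| ^ q)) =
      ∫ u in Set.Ioi (0 : ℝ), t i * t j * (k (y i) u + k (y j) u - k (y i - y j) u) := by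
    intro i j
    rw [integral_const_mul, integral_sub (f := fun u => k (y i) u + k (y j) u)
      ((hk _).add (hk _)) (hk _), integral_add (hk _) (hk _), hkC, hkC, hkC]
    ring
  have hki : ∀ i j, Integrable (fun u => t i * t j * (k (y i) u + k (y j) u - k (y i - y j) u))
      (volume.restrict (Set.Ioi 0)) := fun i j =>
    (((hk _).add (hk _)).sub (hk _)).const_mul _
  have hsum : C * ∑ i ∈ s, ∑ j ∈ s, t i * t j * (|y i| ^ q + |y j| ^ q - |y i - y j| ^ q) =
      ∫ u in Set.Ioi (0 : ℝ), ∑ i ∈ s, ∑ j ∈ s,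
        t i * t j * (k (y i) u + k (y j) u - k (y i - y j) u) := by
    rw [integral_finsetSum _ fun i _ => integrable_finsetSum _ fun j _ => hki i j,
      Finset.mul_sum]
    refine Finset.sum_congr rfl fun i _ => ?_
    rw [integral_finsetSum _ fun j _ => hki i j, Finset.mul_sum]
    exact Finset.sum_congr rfl fun j _ => hterm i j
  refine nonneg_of_mul_nonneg_right ?_ hCpos
  rw [hsum]
  refine setIntegral_nonneg measurableSet_Ioi fun u hu => ?_
  have : ∑ i ∈ s, ∑ j ∈ s, t i * t j * (k (y i) u + k (y j) u - k (y i - y j) u) =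
      ((∑ i ∈ s, t i * (1 - Real.cos (y i * u))) ^ 2 + (∑ i ∈ s, t i * Real.sin (y i * u)) ^ 2)
        * u ^ (-1 - q) := by
    rw [sq, sq, Finset.sum_mul_sum, Finset.sum_mul_sum, ← Finset.sum_add_distrib, Finset.sum_mul]
    refine Finset.sum_congr rfl fun i _ => ?_
    rw [← Finset.sum_add_distrib, Finset.sum_mul]
    refine Finset.sum_congr rfl fun j _ => ?_
    simp only [k, sub_mul (y i) (y j) u, Real.cos_sub]
    ring
  rw [this]
  exact mul_nonneg (by positivity) (Real.rpow_nonneg (le_of_lt hu) _)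

theorem sum_mul_abs_sub_rpow_le {ι : Type*} (s : Finset ι) {q : ℝ} (hq0 : 0 < q) (hq2 : q < 2)
    (t y : ι → ℝ) (ht : ∑ i ∈ s, t i = 1) :
    ∑ i ∈ s, ∑ j ∈ s, t i * t j * |y i - y j| ^ q ≤ 2 * ∑ i ∈ s, t i * |y i| ^ q := by
  have h := sum_mul_rpow_kernel_nonneg s hq0 hq2 t y
  have h1 : ∑ i ∈ s, ∑ j ∈ s, t i * t j * |y i| ^ q = ∑ i ∈ s, t i * |y i| ^ q := by
    refine Finset.sum_congr rfl fun i _ => ?_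
    rw [← Finset.sum_mul, ← Finset.mul_sum, ht, mul_one]
  have h2 : ∑ i ∈ s, ∑ j ∈ s, t i * t j * |y j| ^ q = ∑ i ∈ s, t i * |y i| ^ q := by
    rw [Finset.sum_comm, ← h1]
    exact Finset.sum_congr rfl fun i _ => Finset.sum_congr rfl fun j _ => by ring
  simp only [mul_sub, mul_add, Finset.sum_sub_distrib, Finset.sum_add_distrib] at h
  linarith

/-- For a centred discrete random variable `X` with independent copy `X'` and `p > 2`,
`2 E|X|^p ≤ E|X - X'|^p`. -/
theorem two_mul_sum_mul_abs_rpow_le {ι : Type*} (s : Finset ι) {p : ℝ} (hp : 2 < p)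
    (t x : ι → ℝ) (ht0 : ∀ i ∈ s, 0 ≤ t i) (ht : ∑ i ∈ s, t i = 1)
    (hx : ∑ i ∈ s, t i * x i = 0) :
    2 * ∑ i ∈ s, t i * |x i| ^ p ≤ ∑ i ∈ s, ∑ j ∈ s, t i * t j * |x i - x j| ^ p := by
  have hpq := Real.HolderConjugate.conjExponent (show 1 < p by linarith)
  set q := p.conjExponent with hq
  have hq2 : q < 2 := by
    rw [hq, Real.conjExponent, div_lt_iff₀ (by linarith)]; linarith
  have hq0 : 0 < q := hpq.symm.pos
  let φ : ℝ → ℝ := fun a => |a| ^ (p - 2) * a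
  have hφ : ∀ a, a * φ a = |a| ^ p := by
    intro a
    rcases eq_or_ne a 0 with rfl | ha
    · simp [Real.zero_rpow (show p ≠ 0 by linarith)]
    · have : |a| ^ p = |a| ^ (p - 2) * |a| ^ (2 : ℕ) := by
        rw [← Real.rpow_natCast, ← Real.rpow_add (abs_pos.2 ha)]; congr 1; push_cast; ring
      rw [this, sq_abs]; simp only [φ]; ring
  have hφq : ∀ a, |φ a| ^ q = |a| ^ p := by
    intro a
    rcases eq_or_ne a 0 with rfl | ha
    · simp [φ, Real.zero_rpow (show p ≠ 0 by linarith), Real.zero_rpow hq0.ne']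
    · have h1 : |φ a| = |a| ^ (p - 1) := by
        simp only [φ]
        rw [abs_mul, abs_of_nonneg (by positivity : 0 ≤ |a| ^ (p - 2)),
          ← Real.rpow_add_one (abs_pos.2 ha).ne']
        congr 1; ring
      rw [h1, ← Real.rpow_mul (abs_nonneg _)]
      congr 1
      exact hpq.sub_one_mul_conj
  have hS := sum_mul_abs_sub_rpow_le s hq0 hq2 t (fun i => φ (x i)) ht
  simp only [hφq] at hS
  have hexp : ∑ i ∈ s, ∑ j ∈ s, t i * t j * ((x i - x j) * (φ (x i) - φ (x j))) =
      2 * ∑ i ∈ s, t i * |x i| ^ p := by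
    have e : ∀ i j, t i * t j * ((x i - x j) * (φ (x i) - φ (x j))) =
        (t i * |x i| ^ p) * t j + t i * (t j * |x j| ^ p)
          - (t i * x i) * (t j * φ (x j)) - (t i * φ (x i)) * (t j * x j) := by
      intro i j; rw [← hφ, ← hφ]; ring
    simp only [e, Finset.sum_sub_distrib, Finset.sum_add_distrib, ← Finset.sum_mul_sum, ht, hx]
    ring
  have hY : ∑ i ∈ s, ∑ j ∈ s, t i * t j * ((x i - x j) * (φ (x i) - φ (x j))) ≤
      (∑ i ∈ s, ∑ j ∈ s, t i * t j * |x i - x j| ^ p) / p +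
      (∑ i ∈ s, ∑ j ∈ s, t i * t j * |φ (x i) - φ (x j)| ^ q) / q := by
    rw [Finset.sum_div, Finset.sum_div, ← Finset.sum_add_distrib]
    refine Finset.sum_le_sum fun i hi => ?_
    rw [Finset.sum_div, Finset.sum_div, ← Finset.sum_add_distrib]
    refine Finset.sum_le_sum fun j hj => ?_
    have := mul_le_mul_of_nonneg_left
      (Real.young_inequality (x i - x j) (φ (x i) - φ (x j)) hpq)
      (mul_nonneg (ht0 i hi) (ht0 j hj))
    refine this.trans_eq ?_
    ring
  rw [hexp] at hY
  set S := ∑ i ∈ s, t i * |x i| ^ p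
  have h3 := div_le_div_of_nonneg_right hS hq0.le
  have h4 : 2 * S / q = 2 * S - 2 * S / p := by
    have := hpq.inv_add_inv_eq_one
    rw [div_eq_mul_inv, div_eq_mul_inv]
    linear_combination 2 * S * this
  have hp0 : 0 < p := by linarith
  have h5 : 2 * S / p ≤ (∑ i ∈ s, ∑ j ∈ s, t i * t j * |x i - x j| ^ p) / p := by linarith
  exact (div_le_div_iff_of_pos_right hp0).1 h5

theorem abs_midpoint_rpow_add_le {p : ℝ} (hp : 2 ≤ p) (u v : ℝ) :
    |(u + v) / 2| ^ p + |(u - v) / 2| ^ p ≤ (|u| ^ p + |v| ^ p) / 2 := by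
  have hsq : ∀ a : ℝ, |a| ^ p = (a ^ 2) ^ (p / 2) := by
    intro a
    rw [← sq_abs a, ← Real.rpow_natCast, ← Real.rpow_mul (abs_nonneg _)]
    congr 1; push_cast; ring
  have h1 : 1 ≤ p / 2 := by linarith
  simp only [hsq]
  have h2 : (((u + v) / 2) ^ 2) ^ (p / 2) + (((u - v) / 2) ^ 2) ^ (p / 2) ≤
      (((u + v) / 2) ^ 2 + ((u - v) / 2) ^ 2) ^ (p / 2) := by
    have := NNReal.add_rpow_le_rpow_add ⟨_, sq_nonneg ((u + v) / 2)⟩ ⟨_, sq_nonneg ((u - v) / 2)⟩ h1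
    exact_mod_cast this
  refine h2.trans ?_
  have h3 := (convexOn_rpow h1).2 (Set.mem_Ici.2 (sq_nonneg u)) (Set.mem_Ici.2 (sq_nonneg v))
    (by norm_num : (0 : ℝ) ≤ 1 / 2) (by norm_num : (0 : ℝ) ≤ 1 / 2) (by norm_num)
  simp only [smul_eq_mul] at h3
  have h4 : ((u + v) / 2) ^ 2 + ((u - v) / 2) ^ 2 = 1 / 2 * u ^ 2 + 1 / 2 * v ^ 2 := by ring
  rw [h4]
  linarith

/-- A convex set `G` of nonnegative, `p`-uniformly convex functions contains functions bounded below
by almost `R` everywhere, as soon as near every point some member of `G` is almost at least `R`. -/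
theorem exists_forall_sub_le_of_uniformlyConvex {E : Type*} [NormedAddCommGroup E]
    [NormedSpace ℝ E] {p R M : ℝ} (hp : 0 < p) {G : Set (E → ℝ)} (hG : Convex ℝ G)
    (hne : G.Nonempty) (hnonneg : ∀ f ∈ G, ∀ y, 0 ≤ f y) (hM : ∀ f ∈ G, f 0 ≤ M)
    (hconv : ∀ f ∈ G, ∀ y z,
      f ((1 / 2 : ℝ) • (y + z)) + ‖(1 / 2 : ℝ) • (y - z)‖ ^ p ≤ (f y + f z) / 2)
    (hloc : ∀ ρ > 0, ∃ τ > 0, ∀ y, ∃ g ∈ G, ∀ z, ‖y - z‖ ≤ τ → R - ρ ≤ g z)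
    {ρ : ℝ} (hρ : 0 < ρ) : ∃ f ∈ G, ∀ y, R - ρ ≤ f y := by
  by_contra! hcon
  have hbdd : ∀ f ∈ G, BddBelow (Set.range f) := fun f hf =>
    ⟨0, by rintro _ ⟨y, rfl⟩; exact hnonneg f hf y⟩
  set I : (E → ℝ) → ℝ := fun f => ⨅ y, f y with hI
  have hIle : ∀ f ∈ G, ∀ y, I f ≤ f y := fun f hf y => ciInf_le (hbdd f hf) y
  have hIM : BddAbove (I '' G) :=
    ⟨M, by rintro _ ⟨f, hf, rfl⟩; exact (hIle f hf 0).trans (hM f hf)⟩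
  set v := sSup (I '' G) with hv
  have hIv : ∀ f ∈ G, I f ≤ v := fun f hf => le_csSup hIM ⟨f, hf, rfl⟩
  have hvM : v ≤ M := csSup_le (hne.image I)
    (by rintro _ ⟨f, hf, rfl⟩; exact (hIle f hf 0).trans (hM f hf))
  have hvR : v ≤ R - ρ := csSup_le (hne.image I) (by
    rintro _ ⟨f, hf, rfl⟩
    obtain ⟨y, hy⟩ := hcon f hf
    exact (hIle f hf y).trans hy.le)
  have hv0 : 0 ≤ v := by
    obtain ⟨f, hf⟩ := hne
    exact (le_ciInf fun y => hnonneg f hf y).trans (hIv f hf)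
  obtain ⟨τ, hτ, hloc⟩ := hloc (ρ / 2) (by positivity)
  set σ := (τ / 2) ^ p with hσ
  have hσ0 : 0 < σ := Real.rpow_pos_of_pos (by positivity) _
  have hMρ : 0 < M + ρ := by linarith
  set l := min (1 / 2) (σ / (M + ρ)) with hl
  have hl0 : 0 < l := lt_min (by norm_num) (by positivity)
  have hl1 : l ≤ 1 / 2 := min_le_left _ _
  have hl2 : l * (M + ρ) ≤ σ := (le_div_iff₀ hMρ).1 (min_le_right _ _)
  set δ := l * ρ / 6 with hδ
  have hδ0 : 0 < δ := by positivity
  obtain ⟨_, ⟨f, hf, rfl⟩, hfv⟩ := exists_lt_of_lt_csSup (hne.image I)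
    (show v - δ < sSup (I '' G) by linarith)
  obtain ⟨y, hy⟩ := exists_lt_of_ciInf_lt (show ⨅ y, f y < I f + δ by simp only [hI]; linarith)
  obtain ⟨g, hg, hgy⟩ := hloc y
  have hf' : (1 - l) • f + l • g ∈ G := hG hf hg (by linarith) hl0.le (by ring)
  obtain ⟨z, hz⟩ := exists_lt_of_ciInf_lt
    (show ⨅ y, ((1 - l) • f + l • g) y < v + δ from (hIv _ hf').trans_lt (by linarith))
  simp only [Pi.add_apply, Pi.smul_apply, smul_eq_mul] at hz
  set w := ‖(1 / 2 : ℝ) • (y - z)‖ ^ p with hw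
  have hw0 : 0 ≤ w := by positivity
  have hfz : v - 2 * δ + 2 * w ≤ f z := by
    have h1 := hconv f hf y z
    have h2 := hIle f hf ((1 / 2 : ℝ) • (y + z))
    linarith
  have hmul : (1 - l) * (v - 2 * δ + 2 * w) ≤ (1 - l) * f z :=
    mul_le_mul_of_nonneg_left hfz (by linarith)
  have hwσ : w ≤ σ := by
    have h3 : 0 ≤ l * g z := mul_nonneg hl0.le (hnonneg g hg z)
    have h4 : l * v ≤ l * M := mul_le_mul_of_nonneg_left hvM hl0.le
    have h5 : 0 ≤ (1 / 2 - l) * w := mul_nonneg (by linarith) hw0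
    have h6 : 0 ≤ l * δ := by positivity
    nlinarith
  have hyz : ‖y - z‖ ≤ τ := by
    have h7 := (Real.rpow_le_rpow_iff (norm_nonneg _) (by positivity) hp).1 hwσ
    rw [norm_smul] at h7
    norm_num at h7
    linarith
  have hgz := mul_le_mul_of_nonneg_left (hgy z hyz) hl0.le
  have h8 : 0 ≤ (1 - l) * w := mul_nonneg (by linarith) hw0
  have h9 : l * v ≤ l * (R - ρ) := mul_le_mul_of_nonneg_left hvR hl0.le
  have h10 : 0 < l * δ := by positivity
  nlinarith

section lp

variable {p : ℝ}

theorem lp_hasSum_abs_rpow (hp : 0 < p) (x : lp (fun _ : ℕ => ℝ) (ENNReal.ofReal p)) :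
    HasSum (fun k => |x k| ^ p) (‖x‖ ^ p) := by
  have h : (ENNReal.ofReal p).toReal = p := ENNReal.toReal_ofReal hp.le
  have := lp.hasSum_norm (by rwa [h]) x
  simpa only [h, Real.norm_eq_abs] using this

theorem lp_norm_midpoint_rpow_add_le (hp : 2 ≤ p)
    (u v : lp (fun _ : ℕ => ℝ) (ENNReal.ofReal p)) :
    ‖(1 / 2 : ℝ) • (u + v)‖ ^ p + ‖(1 / 2 : ℝ) • (u - v)‖ ^ p ≤ (‖u‖ ^ p + ‖v‖ ^ p) / 2 := by
  have hp0 : 0 < p := by linarith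
  refine hasSum_le (fun k => ?_)
    ((lp_hasSum_abs_rpow hp0 ((1 / 2 : ℝ) • (u + v))).add
      (lp_hasSum_abs_rpow hp0 ((1 / 2 : ℝ) • (u - v))))
    (((lp_hasSum_abs_rpow hp0 u).add (lp_hasSum_abs_rpow hp0 v)).div_const 2)
  have := abs_midpoint_rpow_add_le hp (u k) (v k)
  simp only [lp.coeFn_smul, lp.coeFn_add, lp.coeFn_sub, Pi.smul_apply, Pi.add_apply,
    Pi.sub_apply, smul_eq_mul]
  rwa [one_div_mul_eq_div, one_div_mul_eq_div]

theorem lp_two_mul_sum_mul_norm_sub_mean_rpow_le (hp : 2 < p) {ι : Type*} (s : Finset ι)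
    (t : ι → ℝ) (x : ι → lp (fun _ : ℕ => ℝ) (ENNReal.ofReal p))
    (ht0 : ∀ i ∈ s, 0 ≤ t i) (ht : ∑ i ∈ s, t i = 1) :
    2 * ∑ i ∈ s, t i * ‖x i - ∑ j ∈ s, t j • x j‖ ^ p ≤
      ∑ i ∈ s, ∑ j ∈ s, t i * t j * ‖x i - x j‖ ^ p := by
  have hp0 : 0 < p := by linarith
  set c := ∑ j ∈ s, t j • x j with hc
  refine hasSum_le (fun k => ?_)
    ((hasSum_sum fun i _ => (lp_hasSum_abs_rpow hp0 (x i - c)).mul_left (t i)).mul_left 2)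
    (hasSum_sum fun i _ => hasSum_sum fun j _ =>
      (lp_hasSum_abs_rpow hp0 (x i - x j)).mul_left (t i * t j))
  have hck : c k = ∑ j ∈ s, t j * x j k := by
    simp only [hc, lp.coeFn_sum, Finset.sum_apply, lp.coeFn_smul, Pi.smul_apply, smul_eq_mul]
  have h := two_mul_sum_mul_abs_rpow_le s hp t (fun i => x i k - c k) ht0 ht (by
    simp only [mul_sub, Finset.sum_sub_distrib, ← Finset.sum_mul, ht, hck, one_mul, sub_self])
  simpa using h

variable [Fact (1 ≤ ENNReal.ofReal p)]

/-- A nonempty bounded set carries finitely supported weights whose mean `p`-th power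
distance to every point is almost the `p`-th power of the radius. -/
theorem exists_weights_chebRadius_rpow_sub_le (hp : 2 ≤ p)
    {A : Set (lp (fun _ : ℕ => ℝ) (ENNReal.ofReal p))} (hbdd : Bornology.IsBounded A)
    (hne : A.Nonempty) (hr : 0 ≤ chebRadius A) {ρ : ℝ} (hρ : 0 < ρ) :
    ∃ (ι : Type) (s : Finset ι) (t : ι → ℝ) (x : ι → lp (fun _ : ℕ => ℝ) (ENNReal.ofReal p)),
      (∀ i ∈ s, 0 ≤ t i) ∧ ∑ i ∈ s, t i = 1 ∧ (∀ i ∈ s, x i ∈ A) ∧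
      ∀ y, chebRadius A ^ p - ρ ≤ ∑ i ∈ s, t i * ‖x i - y‖ ^ p := by
  have hp0 : 0 < p := by linarith
  let F : lp (fun _ : ℕ => ℝ) (ENNReal.ofReal p) → lp (fun _ : ℕ => ℝ) (ENNReal.ofReal p) → ℝ :=
    fun a y => ‖a - y‖ ^ p
  obtain ⟨B, hB⟩ := hbdd.exists_norm_le
  have hull : ∀ f ∈ convexHull ℝ (F '' A), ∃ (ι : Type) (s : Finset ι) (t : ι → ℝ)
      (x : ι → lp (fun _ : ℕ => ℝ) (ENNReal.ofReal p)), (∀ i ∈ s, 0 ≤ t i) ∧ ∑ i ∈ s, t i = 1 ∧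
      (∀ i ∈ s, x i ∈ A) ∧ ∀ y, f y = ∑ i ∈ s, t i * ‖x i - y‖ ^ p := by
    intro f hf
    rw [convexHull_eq] at hf
    obtain ⟨ι, s, t, z, ht0, ht, hz, rfl⟩ := hf
    choose! x hxA hx using hz
    refine ⟨ι, s, t, x, ht0, ht, hxA, fun y => ?_⟩
    rw [Finset.centerMass_eq_of_sum_1 _ _ ht, Finset.sum_apply]
    refine Finset.sum_congr rfl fun i hi => ?_
    simp [← hx i hi, F]
  obtain ⟨f, hf, hfR⟩ := exists_forall_sub_le_of_uniformlyConvex (p := p) (M := B ^ p)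
    (R := chebRadius A ^ p) hp0 (convex_convexHull ℝ (F '' A)) (hne.image F).convexHull
    (fun f hf y => by
      obtain ⟨ι, s, t, x, ht0, ht, -, hfx⟩ := hull f hf
      rw [hfx]
      exact Finset.sum_nonneg fun i hi => mul_nonneg (ht0 i hi) (by positivity))
    (fun f hf => by
      obtain ⟨ι, s, t, x, ht0, ht, hxA, hfx⟩ := hull f hf
      rw [hfx, ← one_mul (B ^ p), ← ht, Finset.sum_mul]
      refine Finset.sum_le_sum fun i hi => mul_le_mul_of_nonneg_left ?_ (ht0 i hi)
      rw [sub_zero]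
      exact Real.rpow_le_rpow (norm_nonneg _) (hB _ (hxA i hi)) hp0.le)
    (fun f hf y z => by
      obtain ⟨ι, s, t, x, ht0, ht, hxA, hfx⟩ := hull f hf
      have hw : ‖(1 / 2 : ℝ) • (y - z)‖ ^ p = ∑ i ∈ s, t i * ‖(1 / 2 : ℝ) • (y - z)‖ ^ p := by
        rw [← Finset.sum_mul, ht, one_mul]
      rw [hfx, hfx, hfx, hw, ← Finset.sum_add_distrib, ← Finset.sum_add_distrib, Finset.sum_div]
      refine Finset.sum_le_sum fun i hi => ?_
      have h := mul_le_mul_of_nonneg_left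
        (lp_norm_midpoint_rpow_add_le hp (x i - y) (x i - z)) (ht0 i hi)
      have e1 : (1 / 2 : ℝ) • (x i - y + (x i - z)) = x i - (1 / 2 : ℝ) • (y + z) := by
        module
      have e2 : ‖(1 / 2 : ℝ) • (x i - y - (x i - z))‖ = ‖(1 / 2 : ℝ) • (y - z)‖ := by
        rw [← norm_neg]; congr 1; module
      rw [e1, e2] at h
      linarith)
    (fun ρ hρ => by
      have hcont : ContinuousAt (fun u : ℝ => u ^ p) (chebRadius A) :=
        Real.continuousAt_rpow_const _ _ (Or.inr hp0.le)
      obtain ⟨η, hη, hηρ⟩ := Metric.continuousAt_iff.1 hcont ρ hρ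
      refine ⟨η / 4, by positivity, fun y => ?_⟩
      have hA : Nonempty A := hne.to_subtype
      have hle : chebRadius A ≤ ⨆ a : A, ‖(a : lp (fun _ : ℕ => ℝ) (ENNReal.ofReal p)) - y‖ :=
        ciInf_le (f := fun y : lp (fun _ : ℕ => ℝ) (ENNReal.ofReal p) =>
            ⨆ a : A, ‖(a : lp (fun _ : ℕ => ℝ) (ENNReal.ofReal p)) - y‖)
          ⟨0, by rintro _ ⟨y, rfl⟩; exact Real.iSup_nonneg fun _ => norm_nonneg _⟩ y
      obtain ⟨a, ha⟩ := exists_lt_of_lt_ciSup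
        (show chebRadius A - η / 4 <
          ⨆ a : A, ‖(a : lp (fun _ : ℕ => ℝ) (ENNReal.ofReal p)) - y‖ by linarith)
      refine ⟨F a, subset_convexHull ℝ _ ⟨a, a.2, rfl⟩, fun z hz => ?_⟩
      have htri : ‖(a : lp (fun _ : ℕ => ℝ) (ENNReal.ofReal p)) - y‖ ≤
          ‖(a : lp (fun _ : ℕ => ℝ) (ENNReal.ofReal p)) - z‖ + ‖y - z‖ := by
        rw [norm_sub_rev y z]; exact norm_sub_le_norm_sub_add_norm_sub _ _ _
      set u := max 0 (chebRadius A - η / 2) with hu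
      have hur : dist u (chebRadius A) < η := by
        rw [Real.dist_eq, abs_lt]
        constructor
        · linarith [le_max_right 0 (chebRadius A - η / 2)]
        · have : u ≤ chebRadius A := max_le hr (by linarith)
          linarith
      have h1 := hηρ hur
      rw [Real.dist_eq, abs_lt] at h1
      have h2 : u ^ p ≤ ‖(a : lp (fun _ : ℕ => ℝ) (ENNReal.ofReal p)) - z‖ ^ p :=
        Real.rpow_le_rpow (le_max_left _ _) (max_le (norm_nonneg _) (by linarith)) hp0.le
      simp only [F]
      linarith [h1.1])
    hρ
  obtain ⟨ι, s, t, x, ht0, ht, hxA, hfx⟩ := hull f hf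
  exact ⟨ι, s, t, x, ht0, ht, hxA, fun y => (hfR y).trans_eq (hfx y)⟩

end lp

/-- Pigeonhole for weights: a partition into `m` cells has within-cell pair mass at least `1 / m`. -/
theorem one_le_card_mul_sum_mul_ite {ι : Type*} (s : Finset ι) (t : ι → ℝ)
    (ht : ∑ i ∈ s, t i = 1) {m : ℕ} (κ : ι → Fin m) :
    1 ≤ m * ∑ i ∈ s, ∑ j ∈ s, t i * t j * (if κ i = κ j then 1 else 0) := by
  have h := sq_sum_le_card_mul_sum_sq (s := (Finset.univ : Finset (Fin m)))
    (f := fun c => ∑ i ∈ s, t i * (if κ i = c then 1 else 0))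
  have h1 : ∑ c : Fin m, ∑ i ∈ s, t i * (if κ i = c then 1 else 0) = 1 := by
    rw [Finset.sum_comm]
    exact (Finset.sum_congr rfl fun i _ => by simp).trans ht
  have h2 : ∑ c : Fin m, (∑ i ∈ s, t i * (if κ i = c then (1 : ℝ) else 0)) ^ 2 =
      ∑ i ∈ s, ∑ j ∈ s, t i * t j * (if κ i = κ j then 1 else 0) := by
    simp only [sq, Finset.sum_mul_sum]
    rw [Finset.sum_comm]
    refine Finset.sum_congr rfl fun i _ => ?_
    rw [Finset.sum_comm]
    refine Finset.sum_congr rfl fun j _ => ?_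
    simp [eq_comm]
  rw [h1, h2] at h
  simpa using h

theorem extremal_kuratowski_large_p (p : ℝ) (hp : 2 < p)
    [Fact (1 ≤ ENNReal.ofReal p)]
    (A : Set (lp (fun _ : ℕ => ℝ) (ENNReal.ofReal p)))
    (hbdd : Bornology.IsBounded A)
    (htwo : ∃ a ∈ A, ∃ b ∈ A, a ≠ b)
    (hext : chebRadius A = 2 ^ (-(1 / p)) * Metric.diam A)
    (ε : ℝ) (hε0 : 0 < ε) (hε1 : ε < Metric.diam A) :
    ¬ ∃ (m : ℕ) (D : Fin m → Set (lp (fun _ : ℕ => ℝ) (ENNReal.ofReal p))),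
        A ⊆ ⋃ i, D i ∧
        ∀ i, EMetric.diam (D i) ≤ ENNReal.ofReal (Metric.diam A - ε) := by
  rintro ⟨m, D, hAD, hD⟩
  obtain ⟨a, haA, -⟩ := htwo
  have hp0 : 0 < p := by linarith
  set d := Metric.diam A with hd
  have hd0 : 0 < d := by linarith
  have hrp : 2 * chebRadius A ^ p = d ^ p := by
    rw [hext, Real.mul_rpow (by positivity) hd0.le, ← Real.rpow_mul (by norm_num)]
    have : -(1 / p) * p = -1 := by field_simp
    rw [this, Real.rpow_neg_one]
    ring
  have hcell : ∀ x ∈ A, ∃ c, x ∈ D c := fun x hx => Set.mem_iUnion.1 (hAD hx)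
  obtain ⟨c₀, -⟩ := hcell a haA
  have hm : (0 : ℝ) < m := by exact_mod_cast c₀.pos
  have hinh : Nonempty (Fin m) := ⟨c₀⟩
  choose! κ hκ using hcell
  set γ := d ^ p - (d - ε) ^ p with hγ
  have hγ0 : 0 < γ := sub_pos.2 (Real.rpow_lt_rpow (by linarith) (by linarith) hp0)
  obtain ⟨ι, s, t, x, ht0, ht, hxA, hmean⟩ := exists_weights_chebRadius_rpow_sub_le hp.le hbdd
    ⟨a, haA⟩ (by rw [hext]; positivity) (show 0 < γ / (4 * m) by positivity)
  have hlow := (mul_le_mul_of_nonneg_left (hmean (∑ j ∈ s, t j • x j)) zero_le_two).trans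
    (lp_two_mul_sum_mul_norm_sub_mean_rpow_le hp s t x ht0 ht)
  have hup : ∑ i ∈ s, ∑ j ∈ s, t i * t j * ‖x i - x j‖ ^ p ≤
      d ^ p - γ * ∑ i ∈ s, ∑ j ∈ s, t i * t j * (if κ (x i) = κ (x j) then 1 else 0) := by
    have h1 : d ^ p = ∑ i ∈ s, ∑ j ∈ s, t i * t j * d ^ p := by
      simp only [← Finset.sum_mul, ← Finset.mul_sum, ht, one_mul]
    rw [h1, Finset.mul_sum, ← Finset.sum_sub_distrib]
    refine Finset.sum_le_sum fun i hi => ?_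
    rw [Finset.mul_sum, ← Finset.sum_sub_distrib]
    refine Finset.sum_le_sum fun j hj => ?_
    have hle : ‖x i - x j‖ ^ p ≤ d ^ p - γ * (if κ (x i) = κ (x j) then 1 else 0) := by
      rw [← dist_eq_norm]
      split_ifs with h
      · have h2 := (Metric.edist_le_ediam_of_mem (hκ _ (hxA i hi))
          (h ▸ hκ _ (hxA j hj))).trans (hD _)
        rw [edist_dist, ENNReal.ofReal_le_ofReal_iff (by linarith)] at h2
        have := Real.rpow_le_rpow dist_nonneg h2 hp0.le
        linarith
      · have := Real.rpow_le_rpow dist_nonneg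
          (Metric.dist_le_diam_of_mem hbdd (hxA i hi) (hxA j hj)) hp0.le
        linarith
    have := mul_le_mul_of_nonneg_left hle (mul_nonneg (ht0 i hi) (ht0 j hj))
    linarith
  have hpig := one_le_card_mul_sum_mul_ite s t ht fun i => κ (x i)
  set P := ∑ i ∈ s, ∑ j ∈ s, t i * t j * (if κ (x i) = κ (x j) then (1 : ℝ) else 0)
  have h3 : γ * P ≤ γ / (2 * m) := by
    have : γ / (2 * m) = 2 * (γ / (4 * m)) := by field_simp; norm_num
    linarith
  rw [le_div_iff₀ (by positivity)] at h3
  nlinarith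
end
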